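/- Let a ≥ 3 be an integer and let Z be a general set of p(a) = (3/2)a(a−1) + 2a + 1 points on a smooth cubic surface X ⊂ ℙ³. Then the graded minimal free resolution of the saturated ideal I_Z over R is 0 → R(−a−3)^{2a} → R(−a−2)^{3a+3} → R(−a)^{a} ⊕ R(−a−1)^{3} ⊕ R(−3) → I_Z → 0. -/

import Mathlib

/-!
Common definitions for formalizing "The minimal resolution conjecture for points
on the cubic surface" (arXiv:math/0611137).

We work with `R = k[x₀,x₁,x₂,x₃]`, closed points of `ℙ³` modeled by
`Projectivization k (Fin 4 → k)`, saturated ideals of sets of points as vanishing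
ideals, genericity expressed by a nonempty basic open subset of the configuration
space, and graded minimal free resolutions expressed by explicit homogeneous
matrices whose entries have zero constant term (no nonzero scalar entries).
-/

open MvPolynomial

noncomputable section

/-- The polynomial ring `R = k[x₀,x₁,x₂,x₃]` in four variables over `k`. -/
abbrev R4 (k : Type) [Field k] : Type := MvPolynomial (Fin 4) k

/-- The (closed) points of the projective space `ℙ³` over `k`. -/
abbrev P3 (k : Type) [Field k] : Type := Projectivization k (Fin 4 → k)

variable (k : Type) [Field k]

/-- A polynomial vanishes at a projective point if it vanishes at every
representative vector of that point. -/
def VanishesAt (f : R4 k) (p : P3 k) : Prop :=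
  ∀ (v : Fin 4 → k) (hv : v ≠ 0), Projectivization.mk k v hv = p → eval v f = 0

/-- The saturated homogeneous ideal `I_Z ⊆ R` of a set `Z` of (reduced) points of
`ℙ³`: all polynomials vanishing at every point of `Z`. -/
def pointsIdeal (Zs : Set (P3 k)) : Ideal (R4 k) where
  carrier := {f | ∀ p ∈ Zs, VanishesAt k f p}
  zero_mem' := by
    intro p _ v hv _
    simp
  add_mem' := by
    intro a b ha hb p hp v hv hmk
    have h1 := ha p hp v hv hmk
    have h2 := hb p hp v hv hmk
    simp [h1, h2]
  smul_mem' := by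
    intro c a ha p hp v hv hmk
    have h1 := ha p hp v hv hmk
    simp [smul_eq_mul, h1]

/-- An ideal of `R` is homogeneous if it is generated by homogeneous elements. -/
def IsHomogIdeal (I : Ideal (R4 k)) : Prop :=
  ∃ G : Set (R4 k), (∀ g ∈ G, ∃ d : ℕ, g.IsHomogeneous d) ∧ I = Ideal.span G

/-- Saturation of an ideal with respect to the irrelevant maximal ideal
`(x₀,…,x₃)`. -/
def satIdeal (I : Ideal (R4 k)) : Ideal (R4 k) where
  carrier := {g | ∀ i : Fin 4, ∃ N : ℕ, (X i : R4 k) ^ N * g ∈ I}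
  zero_mem' := by
    intro i
    exact ⟨0, by simp⟩
  add_mem' := by
    intro a b ha hb i
    obtain ⟨N, hN⟩ := ha i
    obtain ⟨M, hM⟩ := hb i
    refine ⟨N + M, ?_⟩
    have h1 : (X i : R4 k) ^ (N + M) * (a + b)
        = X i ^ M * (X i ^ N * a) + X i ^ N * (X i ^ M * b) := by ring
    rw [h1]
    exact Ideal.add_mem _ (Ideal.mul_mem_left _ _ hN) (Ideal.mul_mem_left _ _ hM)
  smul_mem' := by
    intro c a ha i
    obtain ⟨N, hN⟩ := ha i
    refine ⟨N, ?_⟩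
    have h1 : (X i : R4 k) ^ N * (c • a) = c * (X i ^ N * a) := by
      rw [smul_eq_mul]; ring
    rw [h1]
    exact Ideal.mul_mem_left _ _ hN

/-- The colon ideal `(I : J) = {r | r·J ⊆ I}`. -/
def icolon (I J : Ideal (R4 k)) : Ideal (R4 k) where
  carrier := {r | ∀ x ∈ J, r * x ∈ I}
  zero_mem' := by
    intro x hx
    rw [zero_mul]; exact I.zero_mem
  add_mem' := by
    intro a b ha hb x hx
    rw [add_mul]
    exact Ideal.add_mem _ (ha x hx) (hb x hx)
  smul_mem' := by
    intro c a ha x hx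
    rw [smul_eq_mul, mul_assoc]
    exact Ideal.mul_mem_left _ _ (ha x hx)

/-- A smooth cubic surface `X ⊂ ℙ³`: an irreducible homogeneous cubic form with
no singular zero (Jacobian criterion). -/
structure SmoothCubicSurface (k : Type) [Field k] : Type where
  f : MvPolynomial (Fin 4) k
  homog : f.IsHomogeneous 3
  irred : Irreducible f
  smooth : ∀ v : Fin 4 → k, v ≠ 0 → eval v f = 0 →
    ∃ i : Fin 4, eval v (pderiv i f) ≠ 0

/-- A configuration of `t` distinct points lying on `X`. -/
def ConfigOn (S : SmoothCubicSurface k) {t : ℕ} (Z : Fin t → P3 k) : Prop :=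
  Function.Injective Z ∧ ∀ i, VanishesAt k S.f (Z i)

/-- A configuration avoids the (closed locus of the) polynomial `g` on the
product of the affine cones: some choice of representatives does not annihilate `g`. -/
def Avoids {t : ℕ} (g : MvPolynomial (Fin t × Fin 4) k) (Z : Fin t → P3 k) : Prop :=
  ∃ v : Fin t → Fin 4 → k,
    (∀ i, ∃ hv : v i ≠ 0, Projectivization.mk k (v i) hv = Z i) ∧
    eval (fun q : Fin t × Fin 4 => v q.1 q.2) g ≠ 0

/-- `P` holds for a *general* set of `t` points on `X`: it holds on a nonempty
(basic) Zariski-open subset of the family of all sets of `t` points of `X`. -/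
def GeneralPointsSatisfy (S : SmoothCubicSurface k) (t : ℕ)
    (P : (Fin t → P3 k) → Prop) : Prop :=
  ∃ g : MvPolynomial (Fin t × Fin 4) k,
    (∃ Z : Fin t → P3 k, ConfigOn k S Z ∧ Avoids k g Z) ∧
    (∀ Z : Fin t → P3 k, ConfigOn k S Z → Avoids k g Z → P Z)

/-- An admissible entry of a matrix in a graded **minimal** free resolution,
mapping a generator of degree `d` into a generator of degree `e`: the entry is
homogeneous of degree `d - e`, and it is not a nonzero scalar (zero constant
coefficient). -/
def EntryOk (d e : ℕ) (q : R4 k) : Prop :=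
  (q = 0 ∨ ∃ c : ℕ, d = e + c ∧ q.IsHomogeneous c) ∧ coeff 0 q = 0

/-- Integer-degree version of `EntryOk` (for modules with generators of
arbitrary integer degrees). -/
def EntryOkZ (d e : ℤ) (q : R4 k) : Prop :=
  (q = 0 ∨ ∃ c : ℕ, d = e + (c : ℤ) ∧ q.IsHomogeneous c) ∧ coeff 0 q = 0

/-- The body of a graded minimal free resolution of length 2 over `R` of the
`R`-module `I/J`:
`0 → ⊕ R(-d2 i) --M2--> ⊕ R(-d1 j) --g--> I/J → 0`.
The generators `g j ∈ I` are homogeneous of degree `d1 j` and generate `I` mod `J`;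
`M2` is a homogeneous matrix with no nonzero scalar entries whose rows generate the
kernel, and which is injective. -/
def Res2Body (J I : Ideal (R4 k)) {n1 n2 : ℕ}
    (d1 : Fin n1 → ℕ) (d2 : Fin n2 → ℕ)
    (g : Fin n1 → R4 k) (M2 : Fin n2 → Fin n1 → R4 k) : Prop :=
  (∀ j, g j ∈ I ∧ (g j).IsHomogeneous (d1 j)) ∧
  (∀ x ∈ I, ∃ w : Fin n1 → R4 k, x - ∑ j, w j * g j ∈ J) ∧
  (∀ i j, EntryOk k (d2 i) (d1 j) (M2 i j)) ∧
  (∀ w : Fin n1 → R4 k,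
    ((∑ j, w j * g j) ∈ J) ↔ ∃ u : Fin n2 → R4 k, ∀ j, w j = ∑ i, u i * M2 i j) ∧
  (∀ u : Fin n2 → R4 k, (∀ j, (∑ i, u i * M2 i j) = 0) → u = 0)

/-- `I/J` has a graded minimal free resolution
`0 → ⊕ R(-d2 i) → ⊕ R(-d1 j) → I/J → 0` over `R`. -/
def HasMinFreeRes2 (J I : Ideal (R4 k)) {n1 n2 : ℕ}
    (d1 : Fin n1 → ℕ) (d2 : Fin n2 → ℕ) : Prop :=
  ∃ (g : Fin n1 → R4 k) (M2 : Fin n2 → Fin n1 → R4 k), Res2Body k J I d1 d2 g M2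

/-- The body of a graded minimal free resolution of length 3 over `R` of the
`R`-module `I/J`:
`0 → ⊕ R(-d3 l) --M3--> ⊕ R(-d2 i) --M2--> ⊕ R(-d1 j) --g--> I/J → 0`. -/
def Res3Body (J I : Ideal (R4 k)) {n1 n2 n3 : ℕ}
    (d1 : Fin n1 → ℕ) (d2 : Fin n2 → ℕ) (d3 : Fin n3 → ℕ)
    (g : Fin n1 → R4 k) (M2 : Fin n2 → Fin n1 → R4 k)
    (M3 : Fin n3 → Fin n2 → R4 k) : Prop :=
  (∀ j, g j ∈ I ∧ (g j).IsHomogeneous (d1 j)) ∧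
  (∀ x ∈ I, ∃ w : Fin n1 → R4 k, x - ∑ j, w j * g j ∈ J) ∧
  (∀ i j, EntryOk k (d2 i) (d1 j) (M2 i j)) ∧
  (∀ i j, EntryOk k (d3 i) (d2 j) (M3 i j)) ∧
  (∀ w : Fin n1 → R4 k,
    ((∑ j, w j * g j) ∈ J) ↔ ∃ u : Fin n2 → R4 k, ∀ j, w j = ∑ i, u i * M2 i j) ∧
  (∀ u : Fin n2 → R4 k,
    (∀ j, (∑ i, u i * M2 i j) = 0) ↔ ∃ t : Fin n3 → R4 k, ∀ i, u i = ∑ l, t l * M3 l i) ∧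
  (∀ t : Fin n3 → R4 k, (∀ i, (∑ l, t l * M3 l i) = 0) → t = 0)

/-- `I/J` has a graded minimal free resolution
`0 → ⊕ R(-d3 l) → ⊕ R(-d2 i) → ⊕ R(-d1 j) → I/J → 0` over `R`.
Taking `J = ⊥` this is a resolution of the ideal `I ⊆ R`; taking `J = (f)` it is a
resolution of `I/(f) ⊆ R_X = R/(f)`; taking `J = I_C` a resolution of `I/I_C`. -/
def HasMinFreeRes3 (J I : Ideal (R4 k)) {n1 n2 n3 : ℕ}
    (d1 : Fin n1 → ℕ) (d2 : Fin n2 → ℕ) (d3 : Fin n3 → ℕ) : Prop :=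
  ∃ (g : Fin n1 → R4 k) (M2 : Fin n2 → Fin n1 → R4 k) (M3 : Fin n3 → Fin n2 → R4 k),
    Res3Body k J I d1 d2 d3 g M2 M3

/-- The Betti numbers read off from a minimal free resolution
`0 → F₃ → F₂ → F₁ → I_Z → 0` of the ideal of `Z` (so that
`F_i = ⊕_j R(-i-j)^{b_{i,j}}` in the resolution of `R/I_Z`, with `F₀ = R`). -/
def bettiCount {n1 n2 n3 : ℕ} (d1 : Fin n1 → ℕ) (d2 : Fin n2 → ℕ) (d3 : Fin n3 → ℕ)
    (i j : ℕ) : ℕ :=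
  if i = 0 then (if j = 0 then 1 else 0)
  else if i = 1 then (Finset.univ.filter fun l => d1 l = 1 + j).card
  else if i = 2 then (Finset.univ.filter fun l => d2 l = 2 + j).card
  else if i = 3 then (Finset.univ.filter fun l => d3 l = 3 + j).card
  else 0

/-- The Hilbert polynomial `P_X(t) = (3/2)t(t+1) + 1` of the cubic surface. -/
def PXcubic (t : ℕ) : ℕ := 3 * (t * (t + 1) / 2) + 1

/-- The saturated homogeneous ideal of an integral curve lying on `X`. -/
def IsCurveIdealOn (S : SmoothCubicSurface k) (I : Ideal (R4 k)) : Prop :=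
  IsHomogIdeal k I ∧ I.IsPrime ∧ S.f ∈ I ∧
    ringKrullDim (R4 k ⧸ I) = ((2 : ℕ∞) : WithBot ℕ∞)

/-- The Jacobian criterion at a point of the cone: some 2×2 minor of the Jacobian
matrix of elements of `I` is nonzero, i.e. the curve is smooth there. -/
def CurveSmoothAt (I : Ideal (R4 k)) (v : Fin 4 → k) : Prop :=
  ∃ g₁ ∈ I, ∃ g₂ ∈ I, ∃ i j : Fin 4,
    eval v (pderiv i g₁) * eval v (pderiv j g₂)
      - eval v (pderiv j g₁) * eval v (pderiv i g₂) ≠ 0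

/-- A smooth (integral) curve on `X`. -/
def IsSmoothCurveIdealOn (S : SmoothCubicSurface k) (I : Ideal (R4 k)) : Prop :=
  IsCurveIdealOn k S I ∧
  ∀ v : Fin 4 → k, v ≠ 0 → (∀ g ∈ I, eval v g = 0) → CurveSmoothAt k I v

/-- The coordinate ring `R/I` of a curve has depth 2 (a regular sequence of two
positive-degree homogeneous elements), i.e. the curve is arithmetically
Cohen–Macaulay. -/
def IsACMIdeal (I : Ideal (R4 k)) : Prop :=
  ∃ r₁ r₂ : R4 k,
    (∃ d₁ : ℕ, 0 < d₁ ∧ r₁.IsHomogeneous d₁) ∧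
    (∃ d₂ : ℕ, 0 < d₂ ∧ r₂.IsHomogeneous d₂) ∧
    (∀ x : R4 k, r₁ * x ∈ I → x ∈ I) ∧
    (∀ x : R4 k, r₂ * x ∈ I ⊔ Ideal.span {r₁} → x ∈ I ⊔ Ideal.span {r₁})

/-- The Hilbert function `t ↦ dim_k (R/I)_t`. -/
def hilbFn (I : Ideal (R4 k)) (t : ℕ) : ℕ :=
  Module.finrank k ↥(homogeneousSubmodule (Fin 4) k t) -
    Module.finrank k ↥(homogeneousSubmodule (Fin 4) k t ⊓
      Submodule.restrictScalars k I)

/-- The subscheme with saturated ideal `I` has degree `d` and (arithmetic) genus `g`,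
read off from the Hilbert polynomial `P(t) = d·t + 1 - g`. -/
def HasDegreeGenus (I : Ideal (R4 k)) (d : ℕ) (g : ℤ) : Prop :=
  ∃ N : ℕ, ∀ t : ℕ, N ≤ t → (hilbFn k I t : ℤ) = d * t + 1 - g

/-- Linear equivalence of divisors on `X`: the divisor with (divisorial) ideal `I`
is linearly equivalent to (divisor of `J`) + `a·H`, where `H` is the hyperplane
class.  Concretely, there are homogeneous forms `q, p` with `deg p = deg q + a`,
nonzero on `X`, with `q·I = p·J` in `R_X = R/(f)`.  (Taking `J = ⊤` expresses
that the divisor of `I` is linearly equivalent to `aH`.) -/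
def LinEquivOnX (S : SmoothCubicSurface k) (I J : Ideal (R4 k)) (a : ℤ) : Prop :=
  ∃ (mq mp : ℕ) (q p : R4 k), (mp : ℤ) = (mq : ℤ) + a ∧
    q.IsHomogeneous mq ∧ p.IsHomogeneous mp ∧
    q ∉ Ideal.span {S.f} ∧ p ∉ Ideal.span {S.f} ∧
    Ideal.span {q} * I ⊔ Ideal.span {S.f} = Ideal.span {p} * J ⊔ Ideal.span {S.f}

/-- Linear equivalence, on the curve `C` with ideal `IC`, of the divisor with
ideal `IG` to `r·H_C` (`H_C` the hyperplane section of `C`): there are homogeneous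
forms `q, p`, nonzero on `C`, with `deg p = deg q + r` and `q·I_{G,C} = (p)` in
`R/I_C`. -/
def DivOnCurveEquivH (IC IG : Ideal (R4 k)) (r : ℤ) : Prop :=
  ∃ (mq mp : ℕ) (q p : R4 k), (mp : ℤ) = (mq : ℤ) + r ∧
    q.IsHomogeneous mq ∧ p.IsHomogeneous mp ∧ q ∉ IC ∧ p ∉ IC ∧
    Ideal.span {q} * IG ⊔ IC = Ideal.span {p} ⊔ IC

/-- The saturated homogeneous ideal of a zero-dimensional subscheme of `ℙ³`. -/
def IsZeroDimIdeal (I : Ideal (R4 k)) : Prop :=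
  IsHomogIdeal k I ∧ satIdeal k I = I ∧
    ringKrullDim (R4 k ⧸ I) = ((1 : ℕ∞) : WithBot ℕ∞)

/-- An arithmetically Gorenstein zero-dimensional subscheme of `ℙ³`: its ideal has a
graded minimal free resolution of length 3 whose last free module has rank one. -/
def IsAGPointsIdeal (I : Ideal (R4 k)) : Prop :=
  IsZeroDimIdeal k I ∧
  ∃ (n1 n2 : ℕ) (d1 : Fin n1 → ℕ) (d2 : Fin n2 → ℕ) (s : ℕ),
    HasMinFreeRes3 k ⊥ I d1 d2 (fun _ : Fin 1 => s)

/-- `V₁` and `V₂` are directly Gorenstein linked by the arithmetically Gorenstein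
scheme with ideal `IG`: `I_G ⊆ I_{V₁} ∩ I_{V₂}`, `I_G : I_{V₁} = I_{V₂}` and
`I_G : I_{V₂} = I_{V₁}`. -/
def IsGLinked (IG I1 I2 : Ideal (R4 k)) : Prop :=
  IG ≤ I1 ⊓ I2 ∧ icolon k IG I1 = I2 ∧ icolon k IG I2 = I1

/-- The divisor `G` (with ideal `IG`) on the curve `C ⊂ X` (with ideal `IC`) is
linearly equivalent to `m·H_C - K_C`.  By adjunction on the cubic surface
(`K_X = -H`) this says `G + C|_C ∼ (m+1)·H_C` on `C`, where `C|_C` is realized as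
the scheme-theoretic intersection `C ∩ C'` with any curve `C' ∼ C`, `C' ≠ C`,
chosen disjoint from `G`. -/
def EquivHminusKC (S : SmoothCubicSurface k) (IC IG : Ideal (R4 k)) (m : ℤ) : Prop :=
  ∃ IC' : Ideal (R4 k), IsCurveIdealOn k S IC' ∧ IC' ≠ IC ∧
    LinEquivOnX k S IC' IC 0 ∧
    satIdeal k (satIdeal k (IC ⊔ IC') ⊔ IG) = ⊤ ∧
    DivOnCurveEquivH k IC (IG ⊓ satIdeal k (IC ⊔ IC')) (m + 1)

/-- A line on `X`: a smooth integral curve of degree 1, genus 0 on `X`. -/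
def IsLineOn (S : SmoothCubicSurface k) (I : Ideal (R4 k)) : Prop :=
  IsSmoothCurveIdealOn k S I ∧ HasDegreeGenus k I 1 0

/-- A smooth conic on `X`: a smooth integral curve of degree 2, genus 0 on `X`. -/
def IsConicOn (S : SmoothCubicSurface k) (I : Ideal (R4 k)) : Prop :=
  IsSmoothCurveIdealOn k S I ∧ HasDegreeGenus k I 2 0

/-- A twisted cubic on `X`: a smooth integral curve of degree 3, genus 0 on `X`. -/
def IsTwistedCubicOn (S : SmoothCubicSurface k) (I : Ideal (R4 k)) : Prop :=
  IsSmoothCurveIdealOn k S I ∧ HasDegreeGenus k I 3 0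

/-- The curve `C ⊂ X` moves in a linear system of (projective) dimension `dim`,
i.e. `h⁰(O_X(C)) = dim + 1`.  Global sections of `O_X(C)` are computed, for any
homogeneous `q ∈ I_C` of degree `s` not divisible by `f`, as the degree-`s` part of
the colon ideal `((q, f) : I_C)` modulo `(f)`. -/
def MovesInLinSysOfDim (S : SmoothCubicSurface k) (IC : Ideal (R4 k)) (dim : ℤ) : Prop :=
  ∀ (s : ℕ) (q : R4 k), q.IsHomogeneous s → q ∈ IC → q ∉ Ideal.span {S.f} →
    (Module.finrank k ↥(homogeneousSubmodule (Fin 4) k s ⊓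
        Submodule.restrictScalars k (icolon k (Ideal.span {q} ⊔ Ideal.span {S.f}) IC)) : ℤ)
      - (Module.finrank k ↥(homogeneousSubmodule (Fin 4) k s ⊓
        Submodule.restrictScalars k (icolon k (Ideal.span {q} ⊔ Ideal.span {S.f}) IC) ⊓
        Submodule.restrictScalars k (Ideal.span {S.f})) : ℤ) = dim + 1

/-- `I/(f₀)` is a maximal Cohen–Macaulay module over `R/(f₀)` (3-dimensional):
it admits a regular sequence of three positive-degree homogeneous elements. -/
def IsMCMQuotient (f0 : R4 k) (I : Ideal (R4 k)) : Prop :=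
  ∃ r₁ r₂ r₃ : R4 k,
    (∃ d : ℕ, 0 < d ∧ r₁.IsHomogeneous d) ∧
    (∃ d : ℕ, 0 < d ∧ r₂.IsHomogeneous d) ∧
    (∃ d : ℕ, 0 < d ∧ r₃.IsHomogeneous d) ∧
    (∀ x ∈ I, r₁ * x ∈ Ideal.span {f0} → x ∈ Ideal.span {f0}) ∧
    (∀ x ∈ I, r₂ * x ∈ Ideal.span {r₁} * I ⊔ Ideal.span {f0} →
      x ∈ Ideal.span {r₁} * I ⊔ Ideal.span {f0}) ∧
    (∀ x ∈ I, r₃ * x ∈ Ideal.span {r₁} * I ⊔ Ideal.span {r₂} * I ⊔ Ideal.span {f0} →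
      x ∈ Ideal.span {r₁} * I ⊔ Ideal.span {r₂} * I ⊔ Ideal.span {f0}) ∧
    (∃ x ∈ I, x ∉ Ideal.span {r₁} * I ⊔ Ideal.span {r₂} * I ⊔ Ideal.span {r₃} * I
      ⊔ Ideal.span {f0})

end

namespace MRC

/-- `KIdx n i` indexes the standard basis of the `i`-th exterior power of a free module of
rank `n`. -/
def KIdx : ℕ → ℕ → Type
  | 0, 0 => Unit
  | 0, _ + 1 => Empty
  | n + 1, 0 => KIdx n 0
  | n + 1, i + 1 => KIdx n (i + 1) ⊕ KIdx n i

section Koszul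

set_option linter.unusedSectionVars false

variable {A M N : Type*} [CommRing A] [AddCommGroup M] [Module A M] [AddCommGroup N]

/-- Assemble an element of an exterior power in rank `n + 1` from two in rank `n`. -/
def kpair {n i : ℕ} (a : KIdx n (i + 1) → M) (b : KIdx n i → M) : KIdx (n + 1) (i + 1) → M :=
  Sum.elim a b

/-- The differential of the Koszul complex on `x 0, …, x (n - 1)` with coefficients in `M`. -/
def kd (x : ℕ → A) : (n i : ℕ) → (KIdx n (i + 1) → M) → (KIdx n i → M)
  | 0, _, _ => fun _ => 0
  | n + 1, 0, w => kd x n 0 (fun t => w (Sum.inl t)) + x n • fun t => w (Sum.inr t)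
  | n + 1, i + 1, w => kpair
      (kd x n (i + 1) (fun t => w (Sum.inl t)) + x n • fun t => w (Sum.inr t))
      (- kd x n i (fun t => w (Sum.inr t)))

lemma kpair_surjective {n i : ℕ} (w : KIdx (n + 1) (i + 1) → M) : ∃ a b, w = kpair a b :=
  ⟨fun t => w (Sum.inl t), fun t => w (Sum.inr t), by funext t; rcases t with t | t <;> rfl⟩

lemma kpair_add {n i : ℕ} (a a' : KIdx n (i + 1) → M) (b b' : KIdx n i → M) :
    kpair a b + kpair a' b' = kpair (a + a') (b + b') := by
  funext t; rcases t with t | t <;> rfl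

lemma kpair_comp {n i : ℕ} (φ : M → N) (a : KIdx n (i + 1) → M) (b : KIdx n i → M) :
    (fun s => φ (kpair a b s)) = kpair (fun s => φ (a s)) (fun s => φ (b s)) := by
  funext t; rcases t with t | t <;> rfl

lemma kpair_inj {n i : ℕ} {a a' : KIdx n (i + 1) → M} {b b' : KIdx n i → M}
    (h : kpair a b = kpair a' b') : a = a' ∧ b = b' :=
  ⟨funext fun t => congrFun h (Sum.inl t), funext fun t => congrFun h (Sum.inr t)⟩

lemma kpair_zero {n i : ℕ} : (kpair 0 0 : KIdx (n + 1) (i + 1) → M) = 0 := by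
  funext t; rcases t with t | t <;> rfl

lemma kd_succ_zero (x : ℕ → A) {n : ℕ} (a : KIdx n 1 → M) (b : KIdx n 0 → M) :
    kd x (n + 1) 0 (kpair a b) = kd x n 0 a + x n • b := rfl

lemma kd_succ_succ (x : ℕ → A) {n i : ℕ} (a : KIdx n (i + 2) → M) (b : KIdx n (i + 1) → M) :
    kd x (n + 1) (i + 1) (kpair a b) = kpair (kd x n (i + 1) a + x n • b) (-kd x n i b) := rfl

lemma kd_map {B : Type*} [CommRing B] [Module B N] (x : ℕ → A) (y : ℕ → B)
    (φ φ' : M →+ N) (h : ∀ j m, φ' (x j • m) = y j • φ m) (n i : ℕ) (w : KIdx n (i + 1) → M) :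
    (fun s => φ' (kd x n i w s)) = kd y n i (fun s => φ (w s)) := by
  induction n generalizing i with
  | zero => funext s; simp [kd]
  | succ n ih =>
    obtain ⟨a, b, rfl⟩ := kpair_surjective w
    cases i with
    | zero =>
      rw [kpair_comp, kd_succ_zero, kd_succ_zero, ← ih]
      funext s
      change φ' (kd x n 0 a s + x n • b s) = φ' (kd x n 0 a s) + y n • φ (b s)
      rw [map_add, h]
    | succ i =>
      rw [kpair_comp, kd_succ_succ, kd_succ_succ, kpair_comp, ← ih, ← ih]
      congr 1 <;> funext s
      · simp [h]
      · simp

lemma kd_add (x : ℕ → A) (n i : ℕ) (v w : KIdx n (i + 1) → M) :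
    kd x n i (v + w) = kd x n i v + kd x n i w := by
  induction n generalizing i with
  | zero => funext s; simp [kd]
  | succ n ih =>
    obtain ⟨a, b, rfl⟩ := kpair_surjective v
    obtain ⟨a', b', rfl⟩ := kpair_surjective w
    cases i with
    | zero => rw [kpair_add, kd_succ_zero, kd_succ_zero, kd_succ_zero, ih, smul_add]; abel
    | succ i =>
      rw [kpair_add, kd_succ_succ, kd_succ_succ, kd_succ_succ, ih, ih, smul_add, kpair_add]
      congr 1 <;> abel

lemma kd_smul (x : ℕ → A) (n i : ℕ) (c : A) (w : KIdx n (i + 1) → M) :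
    kd x n i (c • w) = c • kd x n i w :=
  (kd_map x x (DistribSMul.toAddMonoidHom M c) (DistribSMul.toAddMonoidHom M c)
    (fun _ _ => smul_comm _ _ _) n i w).symm

lemma kd_zero (x : ℕ → A) (n i : ℕ) : kd x n i (0 : KIdx n (i + 1) → M) = 0 := by
  simpa using kd_smul x n i 0 (0 : KIdx n (i + 1) → M)

lemma kd_neg (x : ℕ → A) (n i : ℕ) (w : KIdx n (i + 1) → M) :
    kd x n i (-w) = -kd x n i w := by
  simpa using kd_smul x n i (-1) w

lemma kd_sub (x : ℕ → A) (n i : ℕ) (v w : KIdx n (i + 1) → M) :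
    kd x n i (v - w) = kd x n i v - kd x n i w := by
  rw [sub_eq_add_neg, kd_add, kd_neg, sub_eq_add_neg]

lemma kd_kd (x : ℕ → A) (n i : ℕ) (w : KIdx n (i + 2) → M) :
    kd x n i (kd x n (i + 1) w) = 0 := by
  induction n generalizing i with
  | zero => funext s; simp [kd]
  | succ n ih =>
    obtain ⟨a, b, rfl⟩ := kpair_surjective w
    cases i with
    | zero =>
      rw [kd_succ_succ, kd_succ_zero, kd_add, ih, kd_smul, zero_add, smul_neg, add_neg_cancel]; rfl
    | succ i =>
      rw [kd_succ_succ, kd_succ_succ, kd_add, ih, kd_neg, ih, kd_smul, zero_add, smul_neg,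
        add_neg_cancel, neg_zero, neg_zero, kpair_zero]

lemma kd_mem {K : Type*} [Ring K] [Module K M] (x : ℕ → A) (P Q : Submodule K M)
    (h : ∀ j, ∀ m ∈ P, x j • m ∈ Q) (n i : ℕ) (w : KIdx n (i + 1) → M) (hw : ∀ s, w s ∈ P) (s) :
    kd x n i w s ∈ Q := by
  induction n generalizing i with
  | zero => simp [kd]
  | succ n ih =>
    obtain ⟨a, b, rfl⟩ := kpair_surjective w
    have ha : ∀ s, a s ∈ P := fun s => hw (Sum.inl s)
    have hb : ∀ s, b s ∈ P := fun s => hw (Sum.inr s)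
    cases i with
    | zero => exact Q.add_mem (ih 0 a ha s) (h n _ (hb s))
    | succ i =>
      rcases s with s | s
      · exact Q.add_mem (ih _ a ha s) (h n _ (hb s))
      · exact Q.neg_mem (ih _ b hb s)

/-- The cycle condition in the Koszul complex; everything is a cycle in degree zero. -/
def Cyc (x : ℕ → A) (n : ℕ) : (i : ℕ) → (KIdx n i → M) → Prop
  | 0, _ => True
  | i + 1, w => kd x n i w = 0

/-- Exactness of the Koszul complex in positive degrees for a regular sequence. -/
lemma kd_exact_of_regular (x : ℕ → A) (n : ℕ)
    (h : ∀ m < n, ∀ (b : KIdx m 0 → M) (a : KIdx m 1 → M), x m • b = kd x m 0 a →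
      ∃ a', kd x m 0 a' = b) (i : ℕ) (w : KIdx n (i + 1) → M) (hw : kd x n i w = 0) :
    ∃ η, kd x n (i + 1) η = w := by
  induction n generalizing i with
  | zero => exact ⟨fun _ => 0, _root_.funext fun s => Empty.elim s⟩
  | succ n ih =>
    have ih := ih fun m hm => h m (hm.trans n.lt_succ_self)
    obtain ⟨a, b, rfl⟩ := kpair_surjective w
    have key : ∃ e, kd x n i e = b ∧ kd x n i a + x n • b = 0 := by
      cases i with
      | zero =>
        rw [kd_succ_zero] at hw
        obtain ⟨e, he⟩ := h n n.lt_succ_self b (-a) (by rw [kd_neg]; exact eq_neg_of_add_eq_zero_right hw)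
        exact ⟨e, he, hw⟩
      | succ i =>
        rw [kd_succ_succ, ← kpair_zero] at hw
        obtain ⟨h1, h2⟩ := kpair_inj hw
        obtain ⟨e, he⟩ := ih i b (neg_eq_zero.mp h2)
        exact ⟨e, he, h1⟩
    obtain ⟨e, rfl, h1⟩ := key
    obtain ⟨c, hc⟩ := ih i (a + x n • e) (by rw [kd_add, kd_smul, h1])
    refine ⟨kpair c (-e), ?_⟩
    rw [kd_succ_succ, hc, kd_neg, neg_neg, smul_neg, add_neg_cancel_right]

/-- The Koszul complex of a nonzero vector over a field is exact. -/
lemma kd_exact_of_ne_zero {K : Type*} [Field K] (z : ℕ → K) (n : ℕ) (hz : ∃ j < n, z j ≠ 0)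
    (i : ℕ) (w : KIdx n i → K) (hw : Cyc z n i w) : ∃ η, kd z n i η = w := by
  induction n generalizing i with
  | zero => simp at hz
  | succ n ih =>
    by_cases hn : z n = 0
    · have hz' : ∃ j < n, z j ≠ 0 := by
        obtain ⟨j, hj, hj0⟩ := hz
        refine ⟨j, lt_of_le_of_ne (Nat.lt_succ_iff.mp hj) ?_, hj0⟩
        rintro rfl
        exact hj0 hn
      have ih := ih hz'
      cases i with
      | zero =>
        have aux (w : KIdx n 0 → K) : ∃ η, kd z (n + 1) 0 η = w := by
          obtain ⟨e, he⟩ := ih 0 w trivial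
          exact ⟨kpair e 0, by rw [kd_succ_zero, he, smul_zero, add_zero]⟩
        exact aux w
      | succ i =>
        obtain ⟨a, b, rfl⟩ := kpair_surjective w
        have key : kd z n i a = 0 ∧ Cyc z n i b := by
          cases i with
          | zero =>
            have hw : kd z (n + 1) 0 (kpair a b) = 0 := hw
            rw [kd_succ_zero, hn, zero_smul, add_zero] at hw
            exact ⟨hw, trivial⟩
          | succ i =>
            have hw : kd z (n + 1) (i + 1) (kpair a b) = 0 := hw
            rw [kd_succ_succ, ← kpair_zero, hn, zero_smul, add_zero] at hw
            obtain ⟨h1, h2⟩ := kpair_inj hw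
            exact ⟨h1, neg_eq_zero.mp h2⟩
        obtain ⟨e, he⟩ := ih (i + 1) a key.1
        obtain ⟨e', he'⟩ := ih i b key.2
        exact ⟨kpair e (-e'), by rw [kd_succ_succ, he, kd_neg, he', neg_neg, hn, zero_smul, add_zero]⟩
    · cases i with
      | zero =>
        have aux (w : KIdx n 0 → K) : ∃ η, kd z (n + 1) 0 η = w :=
          ⟨kpair 0 ((z n)⁻¹ • w), by rw [kd_succ_zero, kd_zero, zero_add, smul_inv_smul₀ hn]⟩
        exact aux w
      | succ i =>
        obtain ⟨a, b, rfl⟩ := kpair_surjective w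
        have key : kd z n i a + z n • b = 0 := by
          cases i with
          | zero => exact hw
          | succ i =>
            have hw : kd z (n + 1) (i + 1) (kpair a b) = 0 := hw
            rw [kd_succ_succ, ← kpair_zero] at hw
            exact (kpair_inj hw).1
        refine ⟨kpair 0 ((z n)⁻¹ • a), ?_⟩
        rw [kd_succ_succ, kd_zero, zero_add, smul_inv_smul₀ hn, kd_smul,
          eq_neg_of_add_eq_zero_left key, smul_neg, neg_neg, inv_smul_smul₀ hn]

/-- Exactness of a three-term piece of the Koszul complex, where the middle coefficients range
over `P` and the preimages over `Q`. -/
def KEx {K : Type*} [Ring K] [Module K M] (x : ℕ → A) (n : ℕ) (P Q : Submodule K M) (i : ℕ) :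
    Prop :=
  ∀ w : KIdx n i → M, (∀ s, w s ∈ P) → Cyc x n i w → ∃ η, (∀ s, η s ∈ Q) ∧ kd x n i η = w

/-- Dimension shifting along the kernel of a linear map. -/
lemma KEx.shift [Module A N] {K : Type*} [Ring K] [Module K M] [Module K N] {x : ℕ → A} {n i : ℕ}
    {F2 F1 F0 K2 K1 : Submodule K M} {N1 N0 : Submodule K N} (φ : M →ₗ[A] N)
    (hF : KEx x n F2 F1 i) (hN : KEx x n N1 N0 (i + 1)) (hmap : ∀ y ∈ F1, φ y ∈ N1)
    (hsurj : ∀ m ∈ N0, ∃ y ∈ F0, φ y = m) (hx : ∀ j, ∀ y ∈ F0, x j • y ∈ F1)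
    (hK2 : ∀ y ∈ K2, y ∈ F2 ∧ φ y = 0) (hK1 : ∀ y ∈ F1, φ y = 0 → y ∈ K1) :
    KEx x n K2 K1 i := by
  intro w hw hc
  have nat : ∀ j (v : KIdx n (j + 1) → M), (fun s => φ (kd x n j v s)) = kd x n j fun s => φ (v s) :=
    fun j v => kd_map x x φ.toAddMonoidHom φ.toAddMonoidHom (fun j m => φ.map_smul _ _) n j v
  obtain ⟨v, hv, rfl⟩ := hF w (fun s => (hK2 _ (hw s)).1) hc
  obtain ⟨η, hη, hη'⟩ := hN (fun s => φ (v s)) (fun s => hmap _ (hv s)) (by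
    change kd x n i _ = 0
    rw [← nat]
    exact funext fun s => (hK2 _ (hw s)).2)
  choose y hy hyη using fun s => hsurj _ (hη s)
  refine ⟨v - kd x n (i + 1) y, fun s => hK1 _ ?_ ?_, ?_⟩
  · exact F1.sub_mem (hv s) (kd_mem x F0 F1 hx n _ y hy s)
  · have := congrFun ((nat _ y).trans ((congrArg _ (funext hyη)).trans hη')) s
    change φ (v s - kd x n (i + 1) y s) = 0
    rw [map_sub, sub_eq_zero]
    exact this.symm
  · rw [kd_sub, kd_kd, sub_zero]

end Koszul

lemma homogeneousComponent_mul_of_isHomogeneous {σ R : Type*} [CommSemiring R]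
    {u : MvPolynomial σ R} {c : ℕ} (hu : u.IsHomogeneous c) (p : MvPolynomial σ R) (n : ℕ) :
    homogeneousComponent n (u * p) = if c ≤ n then u * homogeneousComponent (n - c) p else 0 := by
  induction p using MvPolynomial.induction_on' with
  | monomial m b =>
    have hm : (monomial m b).IsHomogeneous m.degree := isHomogeneous_monomial _ rfl
    rw [homogeneousComponent_of_mem (hu.mul hm), homogeneousComponent_of_mem hm]
    split_ifs <;> first | rfl | omega | simp
  | add p q hp hq =>
    rw [mul_add, map_add, hp, hq, map_add]
    split_ifs <;> ring

section Grading

variable {k : Type} [Field k]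

/-- The homogeneous forms of degree `d` in the free module `R(-e)`. -/
noncomputable def Gr (k : Type) [Field k] (e d : ℕ) : Submodule k (R4 k) :=
  if e ≤ d then homogeneousSubmodule (Fin 4) k (d - e) else ⊥

/-- The component of degree `d` of an element of `R(-e)`. -/
noncomputable def gc (e d : ℕ) : R4 k →ₗ[k] R4 k :=
  if e ≤ d then homogeneousComponent (d - e) else 0

lemma gr_zero (d : ℕ) : Gr k 0 d = homogeneousSubmodule (Fin 4) k d := by simp [Gr]

lemma gr_of_le {e d : ℕ} (h : e ≤ d) : Gr k e d = homogeneousSubmodule (Fin 4) k (d - e) := by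
  simp [Gr, h]

lemma gr_of_lt {e d : ℕ} (h : d < e) : Gr k e d = ⊥ := by
  simp [Gr, Nat.not_le.mpr h]

instance (d : ℕ) : FiniteDimensional k (homogeneousSubmodule (Fin 4) k d) :=
  Module.Finite.iff_fg.mpr (homogeneousSubmodule_fg _ _ d)

instance (e d : ℕ) : FiniteDimensional k (Gr k e d) := by
  by_cases h : e ≤ d
  · rw [gr_of_le h]
    infer_instance
  · rw [gr_of_lt (by omega)]
    infer_instance

lemma gc_mem (e d : ℕ) (p : R4 k) : gc e d p ∈ Gr k e d := by
  unfold gc Gr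
  split_ifs
  · exact homogeneousComponent_mem _ _
  · simp

lemma gc_of_mem {e d : ℕ} {p : R4 k} (hp : p ∈ Gr k e d) : gc e d p = p := by
  unfold gc
  unfold Gr at hp
  split_ifs at hp ⊢
  · exact homogeneousComponent_eq_self hp
  · simpa using hp.symm

lemma gc_homogeneous_mul {u : R4 k} {c : ℕ} (hu : u.IsHomogeneous c) (e d : ℕ) (p : R4 k) :
    gc e (d + c) (u * p) = u * gc e d p := by
  unfold gc
  by_cases h1 : e ≤ d
  · rw [if_pos h1, if_pos (by omega), homogeneousComponent_mul_of_isHomogeneous hu,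
      if_pos (by omega), show d + c - e - c = d - e by omega]
  · rw [if_neg h1]
    by_cases h2 : e ≤ d + c
    · rw [if_pos h2, homogeneousComponent_mul_of_isHomogeneous hu, if_neg (by omega)]
      simp
    · simp [h2]

lemma gc_mul_of_mem {d1 d2 : ℕ} {m : R4 k} (hm : m ∈ Gr k d1 d2) (d : ℕ) (u : R4 k) :
    gc d1 d (u * m) = gc d2 d u * m := by
  by_cases h : d1 ≤ d2
  · rw [gr_of_le h] at hm
    by_cases h2 : d2 ≤ d
    · obtain ⟨c, rfl⟩ : ∃ c, d = c + (d2 - d1) := ⟨d - (d2 - d1), by omega⟩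
      rw [mul_comm, gc_homogeneous_mul hm, mul_comm]
      congr 1
      unfold gc
      rw [if_pos (by omega), if_pos h2]
      congr 2
      omega
    · unfold gc
      rw [if_neg h2]
      split_ifs
      · rw [mul_comm, homogeneousComponent_mul_of_isHomogeneous hm, if_neg (by omega)]
        simp
      · simp
  · rw [gr_of_lt (by omega)] at hm
    rw [(Submodule.mem_bot k).mp hm]
    simp

lemma homogeneous_mul_mem_gr {u : R4 k} {c : ℕ} (hu : u.IsHomogeneous c) {e d : ℕ} {p : R4 k}
    (hp : p ∈ Gr k e d) : u * p ∈ Gr k e (d + c) := by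
  rw [← gc_of_mem hp, ← gc_homogeneous_mul hu]
  exact gc_mem _ _ _

lemma mul_mem_gr {d d1 d2 : ℕ} {m u : R4 k} (hm : m ∈ Gr k d1 d2) (hu : u ∈ Gr k d2 d) :
    u * m ∈ Gr k d1 d := by
  rw [← gc_of_mem hu, ← gc_mul_of_mem hm]
  exact gc_mem _ _ _

lemma sum_gc {e N : ℕ} {p : R4 k} (h : p.totalDegree + e < N) :
    ∑ d ∈ Finset.range N, gc e d p = p := by
  obtain ⟨M, rfl⟩ : ∃ M, N = e + M := ⟨N - e, by omega⟩
  rw [Finset.sum_range_add]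
  have h1 : ∑ d ∈ Finset.range e, gc e d p = 0 := by
    refine Finset.sum_eq_zero fun d hd => ?_
    rw [gc, if_neg (by simpa using hd)]
    rfl
  have h2 : ∀ d, gc e (e + d) p = homogeneousComponent d p := by
    intro d
    rw [gc, if_pos (by omega)]
    simp
  simp_rw [h1, h2, zero_add]
  conv_rhs => rw [← sum_homogeneousComponent p]
  refine (Finset.sum_subset (Finset.range_mono (by omega)) fun d _ hd => ?_).symm
  exact homogeneousComponent_eq_zero _ _ (by simpa using hd)

/-- The homogeneous elements of degree `d` in the free module `⨁ R(-e j)`. -/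
noncomputable def GrF (k : Type) [Field k] {ι : Type} (e : ι → ℕ) (d : ℕ) :
    Submodule k (ι → R4 k) :=
  Submodule.pi Set.univ fun j => Gr k (e j) d

lemma mem_grF {ι : Type} {e : ι → ℕ} {d : ℕ} {w : ι → R4 k} :
    w ∈ GrF k e d ↔ ∀ j, w j ∈ Gr k (e j) d := by
  simp [GrF]

/-- A submodule contains an element once it contains all its homogeneous components. -/
lemma mem_of_components {ι : Type} [Fintype ι] (e : ι → ℕ) (P : Submodule (R4 k) (ι → R4 k))
    (w : ι → R4 k) (h : ∀ d, (fun j => gc (e j) d (w j)) ∈ P) : w ∈ P := by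
  have hw : w = ∑ d ∈ Finset.range (∑ j, ((w j).totalDegree + e j) + 1),
      fun j => gc (e j) d (w j) := by
    funext j
    rw [Finset.sum_apply, sum_gc]
    exact Nat.lt_succ_of_le
      (Finset.single_le_sum (f := fun j => (w j).totalDegree + e j) (fun _ _ => Nat.zero_le _)
        (Finset.mem_univ j))
  rw [hw]
  exact P.sum_mem fun d _ => h d

/-- The sequence of variables, extended by zero. -/
noncomputable def xv (k : Type) [Field k] (j : ℕ) : R4 k := if h : j < 4 then X ⟨j, h⟩ else 0

lemma xv_isHomogeneous (j : ℕ) : (xv k j).IsHomogeneous 1 := by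
  unfold xv
  split_ifs
  · exact isHomogeneous_X _ _
  · exact isHomogeneous_zero _ _ _

lemma xv_of_lt {j : ℕ} (h : j < 4) : xv k j = X ⟨j, h⟩ := by simp [xv, h]

lemma exists_kd_zero_eq_iff {A : Type*} [CommRing A] (x : ℕ → A) (m : ℕ) (b : KIdx m 0 → A) :
    (∃ a, kd x m 0 a = b) ↔ ∀ s, b s ∈ Ideal.span (x '' Set.Iio m) := by
  induction m with
  | zero =>
    have h : ∀ s, b s ∈ Ideal.span (x '' Set.Iio 0) ↔ b s = 0 := by simp
    simp_rw [h]
    constructor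
    · rintro ⟨a, rfl⟩ s
      rfl
    · exact fun hb => ⟨fun _ => 0, _root_.funext fun s => (hb s).symm⟩
  | succ m ih =>
    have key (b : KIdx m 0 → A) : (∃ a, kd x (m + 1) 0 a = b) ↔
        ∀ s, b s ∈ Ideal.span (x '' Set.Iio (m + 1)) := by
      have hset : x '' Set.Iio (m + 1) = insert (x m) (x '' Set.Iio m) := by
        rw [← Set.image_insert_eq]
        congr 1
        ext j
        simp only [Set.mem_Iio, Set.mem_insert_iff]
        omega
      simp_rw [hset, Ideal.mem_span_insert]
      constructor
      · rintro ⟨w, rfl⟩ s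
        obtain ⟨a, c, rfl⟩ := kpair_surjective w
        refine ⟨c s, kd x m 0 a s, (ih _).mp ⟨a, rfl⟩ s, ?_⟩
        rw [kd_succ_zero, Pi.add_apply, Pi.smul_apply, smul_eq_mul]
        ring
      · intro h
        choose c z hz hb using h
        obtain ⟨a, ha⟩ := (ih z).mpr hz
        refine ⟨kpair a c, ?_⟩
        rw [kd_succ_zero, ha]
        funext s
        rw [hb, Pi.add_apply, Pi.smul_apply, smul_eq_mul]
        ring
    exact key b

lemma mem_span_xv {m : ℕ} (hm : m ≤ 4) {p : R4 k} : p ∈ Ideal.span (xv k '' Set.Iio m) ↔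
    ∀ μ ∈ p.support, ∃ i : Fin 4, (i : ℕ) < m ∧ μ i ≠ 0 := by
  have : xv k '' Set.Iio m = X '' {i : Fin 4 | (i : ℕ) < m} := by
    ext q
    constructor
    · rintro ⟨j, hj, rfl⟩
      exact ⟨⟨j, lt_of_lt_of_le hj hm⟩, hj, (xv_of_lt _).symm⟩
    · rintro ⟨i, hi, rfl⟩
      exact ⟨i, hi, xv_of_lt _⟩
  rw [this, mem_ideal_span_X_image]
  rfl

lemma kd_xv_exact (i : ℕ) (w : KIdx 4 (i + 1) → R4 k) (hw : kd (xv k) 4 i w = 0) :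
    ∃ η, kd (xv k) 4 (i + 1) η = w := by
  refine kd_exact_of_regular _ _ (fun m hm b a h => ?_) i w hw
  rw [exists_kd_zero_eq_iff]
  have h1 := (exists_kd_zero_eq_iff _ _ _).mp ⟨a, h.symm⟩
  intro s
  have h2 := h1 s
  rw [mem_span_xv hm.le, Pi.smul_apply, smul_eq_mul, xv_of_lt hm, mul_comm] at h2
  rw [mem_span_xv hm.le]
  intro μ hμ
  obtain ⟨i, hi, hi0⟩ := h2 (μ + Finsupp.single ⟨m, hm⟩ 1) (by
    rw [support_mul_X]
    exact Finset.mem_map.mpr ⟨μ, hμ, rfl⟩)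
  refine ⟨i, hi, ?_⟩
  rwa [Finsupp.add_apply, Finsupp.single_eq_of_ne, add_zero] at hi0
  rintro rfl
  exact lt_irrefl _ hi

/-- The Koszul complex on the variables with coefficients in a graded free module is exact away
from the generators. -/
lemma kEx_grF {ι : Type} (e : ι → ℕ) (d i : ℕ) (h : i = 0 → ∀ j, e j ≠ d + 1) :
    KEx (xv k) 4 (GrF k e (d + 1)) (GrF k e d) i := by
  intro w hw hc
  have hcomp : ∀ j, ∃ η : KIdx 4 (i + 1) → R4 k, kd (xv k) 4 i η = fun s => w s j := by
    intro j
    cases i with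
    | zero =>
      rw [exists_kd_zero_eq_iff]
      intro s
      rw [mem_span_xv le_rfl]
      intro μ hμ
      by_contra hcon
      have hcon : ∀ i, μ i = 0 := by
        intro i
        by_contra h0
        exact hcon ⟨i, i.2, h0⟩
      have hws := mem_grF.mp (hw s) j
      have hej := h rfl j
      by_cases hle : e j ≤ d + 1
      · rw [gr_of_le hle] at hws
        have := ((mem_homogeneousSubmodule _ _).mp hws) (mem_support_iff.mp hμ)
        rw [Finsupp.weight_apply] at this
        simp [Finsupp.sum, hcon] at this
        omega
      · rw [gr_of_lt (by omega)] at hws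
        rw [(Submodule.mem_bot k).mp hws] at hμ
        simp at hμ
    | succ i =>
      refine kd_xv_exact i _ ?_
      have := kd_map (xv k) (xv k) (Pi.evalAddMonoidHom (fun _ => R4 k) j)
        (Pi.evalAddMonoidHom (fun _ => R4 k) j) (fun _ _ => rfl) 4 i w
      refine this.symm.trans ?_
      have hc : kd (xv k) 4 i w = 0 := hc
      rw [hc]
      rfl
  choose η hη using hcomp
  refine ⟨fun s j => gc (e j) d (η j s), fun s => mem_grF.mpr fun j => gc_mem _ _ _, ?_⟩
  have h1 : ∀ j, (fun s => kd (xv k) 4 i (fun s j => gc (e j) d (η j s)) s j) =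
      fun s => w s j := by
    intro j
    have h2 := kd_map (xv k) (xv k) (Pi.evalAddMonoidHom (fun _ => R4 k) j)
      (Pi.evalAddMonoidHom (fun _ => R4 k) j) (fun _ _ => rfl) 4 i
      (fun s j => gc (e j) d (η j s))
    have h3 := kd_map (xv k) (xv k) (gc (k := k) (e j) d).toAddMonoidHom
      (gc (e j) (d + 1)).toAddMonoidHom
      (fun l m => gc_homogeneous_mul (xv_isHomogeneous l) _ _ _) 4 i (η j)
    refine h2.trans (h3.symm.trans ?_)
    rw [hη]
    exact _root_.funext fun s => gc_of_mem (mem_grF.mp (hw s) j)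
  exact _root_.funext fun s => _root_.funext fun j => congrFun (h1 j) s

/-- Exactness at the bottom of the Koszul complex means generation by the previous degree. -/
lemma KEx.mem_of_forall_mem {A M K : Type*} [CommRing A] [AddCommGroup M] [Module A M] [Ring K]
    [Module K M] {x : ℕ → A} {n : ℕ} {P Q : Submodule K M} (h : KEx x n P Q 0)
    (T : Submodule A M) (hT : ∀ m ∈ Q, m ∈ T) : ∀ m ∈ P, m ∈ T := by
  intro m hm
  obtain ⟨η, hη, h1⟩ := h (fun _ => m) (fun _ => hm) trivial
  have hne : ∀ n, Nonempty (KIdx n 0) := by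
    intro n
    induction n with
    | zero => exact ⟨()⟩
    | succ n ih => exact ih
  obtain ⟨s⟩ := hne n
  rw [← congrFun h1 s]
  exact kd_mem x T T (fun j m hm => T.smul_mem _ hm) n 0 η (fun s => hT _ (hη s)) s

end Grading

section Dimensions

variable {k : Type} [Field k]

lemma finrank_homogeneousSubmodule (d : ℕ) :
    Module.finrank k (homogeneousSubmodule (Fin 4) k d) = (d + 3).choose d := by
  let s : Finset (Fin 4 →₀ ℕ) := Finset.univ.finsuppAntidiag d
  have hs : ∀ m, m ∈ s ↔ m.degree = d := by
    intro m
    simp [s, Finsupp.degree_eq_sum]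
  have h1 : homogeneousSubmodule (Fin 4) k d =
      Submodule.span k (Set.range fun m : s => (monomial m.1 1 : R4 k)) := by
    apply le_antisymm
    · intro p hp
      rw [← p.support_sum_monomial_coeff]
      refine Submodule.sum_mem _ fun m hm => ?_
      have hd : m.degree = d := by
        by_contra h
        exact (mem_support_iff.mp hm) (IsHomogeneous.coeff_eq_zero hp h)
      have := Submodule.smul_mem _ (coeff m p) (Submodule.subset_span (R := k)
        (s := Set.range fun m : s => (monomial m.1 1 : R4 k)) ⟨⟨m, (hs m).mpr hd⟩, rfl⟩)
      simpa [smul_monomial] using this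
    · rw [Submodule.span_le]
      rintro _ ⟨m, rfl⟩
      exact isHomogeneous_monomial _ ((hs _).mp m.2)
  have h2 : LinearIndependent k fun m : s => (monomial m.1 1 : R4 k) :=
    ((basisMonomials (Fin 4) k).linearIndependent.comp _ Subtype.val_injective :)
  rw [h1, finrank_span_eq_card h2, Fintype.card_coe, Finset.card_finsuppAntidiag_nat_eq_choose,
    Finset.card_univ, Fintype.card_fin]
  congr 1
  omega

lemma six_mul_finrank_homogeneousSubmodule (d : ℕ) :
    6 * Module.finrank k (homogeneousSubmodule (Fin 4) k d) = (d + 1) * (d + 2) * (d + 3) := by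
  rw [finrank_homogeneousSubmodule, Nat.choose_symm_add]
  have := Nat.descFactorial_eq_factorial_mul_choose (d + 3) 3
  simp [Nat.descFactorial, Nat.factorial] at this
  linarith
/-- The forms of degree `d` divisible by `f`. -/
noncomputable def Fd (f : R4 k) (d : ℕ) : Submodule k (R4 k) :=
  homogeneousSubmodule (Fin 4) k d ⊓ (Ideal.span {f}).restrictScalars k

/-- The forms of degree `d` vanishing at all the vectors `z i`. -/
noncomputable def Iz {ι : Type} (z : ι → Fin 4 → k) (d : ℕ) : Submodule k (R4 k) where
  carrier := {p | p.IsHomogeneous d ∧ ∀ i, eval (z i) p = 0}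
  zero_mem' := ⟨isHomogeneous_zero _ _ _, fun i => map_zero _⟩
  add_mem' := fun hp hq => ⟨hp.1.add hq.1, fun i => by rw [map_add, hp.2, hq.2, add_zero]⟩
  smul_mem' := fun c p hp => ⟨(homogeneousSubmodule (Fin 4) k d).smul_mem c hp.1,
    fun i => by rw [smul_eval, hp.2, mul_zero]⟩

lemma mem_fd {f : R4 k} {d : ℕ} {p : R4 k} : p ∈ Fd f d ↔ p.IsHomogeneous d ∧ f ∣ p := by
  simp [Fd, Ideal.mem_span_singleton]

lemma mem_iz {ι : Type} {z : ι → Fin 4 → k} {d : ℕ} {p : R4 k} :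
    p ∈ Iz z d ↔ p.IsHomogeneous d ∧ ∀ i, eval (z i) p = 0 := Iff.rfl

lemma mem_fd_iff_exists {f : R4 k} (hf : f.IsHomogeneous 3) {d : ℕ} {p : R4 k} :
    p ∈ Fd f d ↔ ∃ r ∈ Gr k 3 d, r * f = p := by
  rw [mem_fd]
  have hf' : f ∈ Gr k 0 3 := by rwa [gr_zero]
  constructor
  · rintro ⟨hp, q, rfl⟩
    refine ⟨gc 3 d q, gc_mem _ _ _, ?_⟩
    rw [← gc_mul_of_mem hf' d q, mul_comm]
    exact gc_of_mem (by rwa [gr_zero])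
  · rintro ⟨r, hr, rfl⟩
    refine ⟨?_, Dvd.intro_left _ rfl⟩
    have := mul_mem_gr hf' hr
    rwa [gr_zero] at this

lemma fd_eq_bot {f : R4 k} (hf : f.IsHomogeneous 3) {d : ℕ} (hd : d < 3) : Fd f d = ⊥ := by
  rw [eq_bot_iff]
  intro p hp
  obtain ⟨r, hr, rfl⟩ := (mem_fd_iff_exists hf).mp hp
  rw [gr_of_lt hd, Submodule.mem_bot] at hr
  simp [hr]

lemma finrank_fd {f : R4 k} (hf : f.IsHomogeneous 3) (h0 : f ≠ 0) (d : ℕ) :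
    Module.finrank k (Fd f d) = Module.finrank k (Gr k 3 d) := by
  have h1 : Fd f d = (Gr k 3 d).map (LinearMap.mulRight k f) := by
    ext p
    rw [mem_fd_iff_exists hf]
    rfl
  rw [h1]
  exact (Submodule.equivMapOfInjective _ (mul_left_injective₀ h0) _).finrank_eq.symm

instance (f : R4 k) (d : ℕ) : FiniteDimensional k (Fd f d) := by
  unfold Fd; infer_instance

instance {ι : Type} (z : ι → Fin 4 → k) (d : ℕ) : FiniteDimensional k (Iz z d) :=
  Submodule.finiteDimensional_of_le (S₂ := homogeneousSubmodule (Fin 4) k d) fun _ h => h.1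

lemma two_mul_finrank_homogeneousSubmodule {f : R4 k} (hf : f.IsHomogeneous 3) (h0 : f ≠ 0)
    (d : ℕ) : 2 * Module.finrank k (homogeneousSubmodule (Fin 4) k d) =
      2 * Module.finrank k (Fd f d) + 3 * d * (d + 1) + 2 := by
  rw [finrank_fd hf h0]
  have h1 := six_mul_finrank_homogeneousSubmodule (k := k) d
  by_cases h : 3 ≤ d
  · rw [gr_of_le h]
    have h2 := six_mul_finrank_homogeneousSubmodule (k := k) (d - 3)
    obtain ⟨e, rfl⟩ : ∃ e, d = e + 3 := ⟨d - 3, by omega⟩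
    rw [Nat.add_sub_cancel] at h2 ⊢
    linarith
  · rw [gr_of_lt (by omega), finrank_bot]
    interval_cases d <;> omega

/-- The graded pieces of a free module are products. -/
def grFEquiv {ι : Type} (e : ι → ℕ) (d : ℕ) : GrF k e d ≃ₗ[k] ∀ j, Gr k (e j) d where
  toFun w j := ⟨w.1 j, mem_grF.mp w.2 j⟩
  invFun w := ⟨fun j => w j, mem_grF.mpr fun j => (w j).2⟩
  map_add' _ _ := rfl
  map_smul' _ _ := rfl
  left_inv _ := rfl
  right_inv _ := rfl

lemma finrank_grF {ι : Type} [Fintype ι] (e : ι → ℕ) (d : ℕ) :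
    Module.finrank k (GrF k e d) = ∑ j, Module.finrank k (Gr k (e j) d) := by
  rw [(grFEquiv e d).finrank_eq, Module.finrank_pi_fintype]

instance {ι : Type} [Fintype ι] (e : ι → ℕ) (d : ℕ) : FiniteDimensional k (GrF k e d) :=
  Module.Finite.equiv (grFEquiv e d).symm

/-- A basis of `V` modulo `U`. -/
lemma exists_basis_mod {M : Type*} [AddCommGroup M] [Module k M] {U V : Submodule k M}
    [FiniteDimensional k V] (hUV : U ≤ V) {n : ℕ}
    (h : Module.finrank k V = Module.finrank k U + n) :
    ∃ g : Fin n → M, (∀ j, g j ∈ V) ∧ (∀ c : Fin n → k, ∑ j, c j • g j ∈ U → c = 0) ∧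
      ∀ v ∈ V, ∃ c : Fin n → k, v - ∑ j, c j • g j ∈ U := by
  let U' := U.comap V.subtype
  have hU' : Module.finrank k U' = Module.finrank k U :=
    (Submodule.comapSubtypeEquivOfLe hUV).finrank_eq
  have hq : Module.finrank k (V ⧸ U') = n := by
    have := U'.finrank_quotient_add_finrank
    omega
  let b := Module.finBasisOfFinrankEq k (V ⧸ U') hq
  choose g hg using fun j => U'.mkQ_surjective (b j)
  have key : ∀ c : Fin n → k, ∀ v : V, (v : M) - ∑ j, c j • (g j : M) ∈ U ↔
      U'.mkQ v = ∑ j, c j • b j := by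
    intro c v
    have h1 : ∑ j, c j • b j = U'.mkQ (∑ j, c j • g j) := by simp [← hg]
    rw [h1, ← sub_eq_zero, ← map_sub, Submodule.mkQ_apply, Submodule.Quotient.mk_eq_zero]
    simp [U']
  refine ⟨fun j => g j, fun j => (g j).2, fun c hc => ?_, fun v hv => ?_⟩
  · have h2 := (key c 0).mp (by simpa using U.neg_mem hc)
    rw [map_zero] at h2
    exact _root_.funext (Fintype.linearIndependent_iff.mp b.linearIndependent c h2.symm)
  · exact ⟨b.repr (U'.mkQ ⟨v, hv⟩), (key _ ⟨v, hv⟩).mpr (b.sum_repr _).symm⟩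

end Dimensions

section Points

variable {k : Type} [Field k]

lemma kIdx_isEmpty : ∀ {n m : ℕ}, n < m → IsEmpty (KIdx n m)
  | 0, _ + 1, _ => inferInstanceAs (IsEmpty Empty)
  | n + 1, m + 1, h => by
    have := @kIdx_isEmpty n (m + 1) (by omega)
    have := @kIdx_isEmpty n m (by omega)
    exact inferInstanceAs (IsEmpty (KIdx n (m + 1) ⊕ KIdx n m))

lemma kEx_homogeneousSubmodule (d i : ℕ) : KEx (xv k) 4 (homogeneousSubmodule (Fin 4) k (d + 1))
    (homogeneousSubmodule (Fin 4) k d) i := by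
  intro w hw hc
  have nat : ∀ i (v : KIdx 4 (i + 1) → Unit → R4 k), (fun s => kd (xv k) 4 i v s ()) =
      kd (xv k) 4 i fun s => v s () := fun i v =>
    kd_map (xv k) (xv k) (Pi.evalAddMonoidHom (fun _ : Unit => R4 k) ())
      (Pi.evalAddMonoidHom (fun _ => R4 k) ()) (fun _ _ => rfl) 4 i v
  obtain ⟨η, hη, h1⟩ := kEx_grF (k := k) (fun _ : Unit => 0) d i (fun _ _ => by omega)
    (fun s _ => w s) (fun s => mem_grF.mpr fun _ => by rw [gr_zero]; exact hw s) (by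
      cases i with
      | zero => trivial
      | succ i =>
        exact _root_.funext fun s => _root_.funext fun _ =>
          congrFun ((nat i (fun s _ => w s)).trans hc) s)
  refine ⟨fun s => η s (), fun s => ?_, ?_⟩
  · have := mem_grF.mp (hη s) ()
    rwa [gr_zero] at this
  · rw [← nat, h1]

/-- A vector in `k⁴` as a sequence. -/
def zv (z : Fin 4 → k) (j : ℕ) : k := if h : j < 4 then z ⟨j, h⟩ else 0

lemma eval_xv (z : Fin 4 → k) (j : ℕ) : eval z (xv k j) = zv z j := by
  unfold xv zv
  split_ifs <;> simp

/-- Evaluation of polynomials at a family of vectors. -/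
noncomputable def evs {ι : Type} (z : ι → Fin 4 → k) : R4 k →ₗ[k] (ι → k) :=
  LinearMap.pi fun i => (aeval (z i)).toLinearMap

@[simp] lemma evs_apply {ι : Type} (z : ι → Fin 4 → k) (p : R4 k) (i : ι) :
    evs z p i = eval (z i) p := by
  simp [evs, aeval_eq_eval]

/-- Evaluation at the vectors `z` is surjective on forms of degree `d`. -/
def Sep {ι : Type} (z : ι → Fin 4 → k) (d : ℕ) : Prop :=
  ∀ c : ι → k, ∃ q : R4 k, q.IsHomogeneous d ∧ ∀ i, eval (z i) q = c i

lemma kEx_iz {ι : Type} {z : ι → Fin 4 → k} (hz : ∀ i, z i ≠ 0) (d i : ℕ)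
    (h : 3 ≤ i ∨ ∃ d', d = d' + 1 ∧ Sep z d') :
    KEx (xv k) 4 (Iz z (d + 1)) (Iz z d) i := by
  intro w hw hc
  obtain ⟨η, hη, rfl⟩ := kEx_homogeneousSubmodule d i w (fun s => (hw s).1) hc
  have nat : ∀ l i (v : KIdx 4 (i + 1) → R4 k), (fun s => eval (z l) (kd (xv k) 4 i v s)) =
      kd (zv (z l)) 4 i fun s => eval (z l) (v s) := fun l i v =>
    kd_map (xv k) (zv (z l)) (eval (z l)).toAddMonoidHom (eval (z l)).toAddMonoidHom
      (fun j m => by simp [eval_xv]) 4 i v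
  have hex : ∀ l, ∃ ζ, kd (zv (z l)) 4 (i + 1) ζ = fun s => eval (z l) (η s) := by
    intro l
    refine kd_exact_of_ne_zero _ _ ?_ _ _ ?_
    · obtain ⟨j, hj⟩ := Function.ne_iff.mp (hz l)
      exact ⟨j, j.2, by simpa [zv] using hj⟩
    · change kd (zv (z l)) 4 i _ = 0
      rw [← nat]
      exact _root_.funext fun s => (hw s).2 l
  choose ζ hζ using hex
  obtain ⟨y, hy, hyζ⟩ : ∃ y : KIdx 4 (i + 2) → R4 k,
      (∀ s, kd (xv k) 4 (i + 1) y s ∈ homogeneousSubmodule (Fin 4) k d) ∧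
      ∀ l s, eval (z l) (y s) = ζ l s := by
    rcases h with h | ⟨d', rfl, hsep⟩
    · have := kIdx_isEmpty (show 4 < i + 2 by omega)
      refine ⟨0, fun s => ?_, fun l s => isEmptyElim s⟩
      rw [kd_zero]
      exact Submodule.zero_mem _
    · choose y hy using fun s : KIdx 4 (i + 2) => hsep fun l => ζ l s
      refine ⟨y, fun s => ?_, fun l s => (hy s).2 l⟩
      refine kd_mem (xv k) (homogeneousSubmodule (Fin 4) k d') _ (fun j m hm => ?_) _ _ y
        (fun s => (hy s).1) s
      rw [smul_eq_mul, mul_comm]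
      exact IsHomogeneous.mul hm (xv_isHomogeneous j)
  refine ⟨η - kd (xv k) 4 (i + 1) y, fun s => ⟨?_, fun l => ?_⟩, ?_⟩
  · exact Submodule.sub_mem _ (hη s) (hy s)
  · have h1 := congrFun (nat l (i + 1) y) s
    have h2 := congrFun (hζ l) s
    simp_rw [hyζ] at h1
    rw [Pi.sub_apply, map_sub, h1, h2, sub_self]
  · rw [kd_sub, kd_kd, sub_zero]

lemma sep_of_independent {ι : Type} [Fintype ι] {z : ι → Fin 4 → k} {d : ℕ}
    (h : ∀ c : ι → k, (∀ q : R4 k, q.IsHomogeneous d →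
      ∑ i, c i * eval (z i) q = 0) → c = 0) : Sep z d := by
  classical
  by_contra hcon
  have hlt : (homogeneousSubmodule (Fin 4) k d).map (evs z) < ⊤ := by
    rw [lt_top_iff_ne_top]
    intro htop
    refine hcon fun c => ?_
    obtain ⟨q, hq, rfl⟩ := (htop ▸ Submodule.mem_top : c ∈ Submodule.map (evs z) _)
    exact ⟨q, hq, fun i => by simp⟩
  obtain ⟨φ, hφ, hle⟩ := Submodule.exists_le_ker_of_lt_top _ hlt
  refine hφ ?_
  have hc := h (fun i => φ (Pi.single i 1)) fun q hq => ?_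
  · refine LinearMap.pi_ext' fun i => LinearMap.ext_ring ?_
    simpa using congrFun hc i
  · have h1 : φ (evs z q) = 0 := hle ⟨q, hq, rfl⟩
    rw [LinearMap.pi_apply_eq_sum_univ] at h1
    rw [← h1]
    refine Finset.sum_congr rfl fun i _ => ?_
    rw [evs_apply, smul_eq_mul, mul_comm]
    congr 2
    funext j
    simp [Pi.single_apply, eq_comm]

lemma Sep.succ {ι : Type} [Finite ι] {z : ι → Fin 4 → k} (hz : ∀ i, z i ≠ 0) {d : ℕ}
    (h : Sep z d) : Sep z (d + 1) := by
  classical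
  have := Fintype.ofFinite ι
  intro c
  choose j hj using fun i => Function.ne_iff.mp (hz i)
  choose q hq using fun i => h (Pi.single i ((z i (j i))⁻¹ * c i))
  refine ⟨∑ i, q i * X (j i), IsHomogeneous.sum _ _ _ fun i _ =>
    (hq i).1.mul (isHomogeneous_X _ _), fun i => ?_⟩
  rw [map_sum, Finset.sum_eq_single i]
  · rw [map_mul, (hq i).2, eval_X, Pi.single_eq_same]
    exact mul_right_comm (z i (j i))⁻¹ (c i) _ ▸ by rw [inv_mul_cancel₀ (hj i), one_mul]
  · intro i' _ hi'
    rw [map_mul, (hq i').2, Pi.single_eq_of_ne hi'.symm, zero_mul]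
  · simp

lemma Sep.mono {ι : Type} [Finite ι] {z : ι → Fin 4 → k} (hz : ∀ i, z i ≠ 0) {d d' : ℕ}
    (h : Sep z d) (hd : d ≤ d') : Sep z d' := by
  induction d', hd using Nat.le_induction with
  | base => exact h
  | succ d' _ ih => exact ih.succ hz

lemma Sep.finrank {ι : Type} [Fintype ι] {z : ι → Fin 4 → k} {d : ℕ} (h : Sep z d) :
    Module.finrank k (homogeneousSubmodule (Fin 4) k d) =
      Module.finrank k (Iz z d) + Fintype.card ι := by
  let φ := (evs z).domRestrict (homogeneousSubmodule (Fin 4) k d)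
  have h1 : LinearMap.range φ = ⊤ := by
    rw [LinearMap.range_eq_top]
    intro c
    obtain ⟨q, hq, hc⟩ := h c
    exact ⟨⟨q, hq⟩, _root_.funext fun i => by simpa [φ] using hc i⟩
  have h2 : (LinearMap.ker φ).map (Submodule.subtype _) = Iz z d := by
    ext p
    simp only [Submodule.mem_map, LinearMap.mem_ker, Submodule.coe_subtype, mem_iz]
    constructor
    · rintro ⟨q, hq, rfl⟩
      exact ⟨q.2, fun i => by simpa [φ] using congrFun hq i⟩
    · rintro ⟨hp, hz⟩
      exact ⟨⟨p, hp⟩, _root_.funext fun i => by simpa [φ] using hz i, rfl⟩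
  have h3 := φ.finrank_range_add_finrank_ker
  rw [h1, finrank_top, Module.finrank_fintype_fun_eq_card] at h3
  have h4 := LinearEquiv.finrank_eq
    (Submodule.equivMapOfInjective _ (Submodule.subtype_injective _) (LinearMap.ker φ))
  rw [h2] at h4
  linarith

end Points

section Syzygies

variable {k : Type} [Field k] {ι κ : Type} {M : Type*} [AddCommGroup M] [Module (R4 k) M]

/-- The homogeneous elements of degree `d` in the kernel of a map from a graded free module. -/
noncomputable def Syz (e : ι → ℕ) (φ : (ι → R4 k) →ₗ[R4 k] M) (d : ℕ) : Submodule k (ι → R4 k) :=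
  GrF k e d ⊓ (LinearMap.ker φ).restrictScalars k

lemma mem_syz {e : ι → ℕ} {φ : (ι → R4 k) →ₗ[R4 k] M} {d : ℕ} {w : ι → R4 k} :
    w ∈ Syz e φ d ↔ w ∈ GrF k e d ∧ φ w = 0 := Iff.rfl

lemma kEx_syz [Module k M] {N : ℕ → Submodule k M} {e : ι → ℕ} {φ : (ι → R4 k) →ₗ[R4 k] M}
    {d i : ℕ} (hmap : ∀ d, ∀ y ∈ GrF k e d, φ y ∈ N d)
    (hsurj : ∀ m ∈ N d, ∃ y ∈ GrF k e d, φ y = m)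
    (hN : KEx (xv k) 4 (N (d + 1)) (N d) (i + 1)) (hF : i = 0 → ∀ j, e j ≠ d + 2) :
    KEx (xv k) 4 (Syz e φ (d + 2)) (Syz e φ (d + 1)) i :=
  KEx.shift φ (kEx_grF e (d + 1) i hF) hN (hmap _) hsurj
    (fun j _ hy => mem_grF.mpr fun l =>
      homogeneous_mul_mem_gr (xv_isHomogeneous j) (mem_grF.mp hy l))
    (fun _ hy => mem_syz.mp hy) (fun _ hy h => mem_syz.mpr ⟨hy, h⟩)

lemma mem_of_forall_syz_mem [Fintype ι] {e : ι → ℕ} {φ : (ι → R4 k) →ₗ[R4 k] M}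
    (hφ : ∀ w, φ w = 0 → ∀ d, φ (fun j => gc (e j) d (w j)) = 0)
    {P : Submodule (R4 k) (ι → R4 k)} (h : ∀ d, ∀ w ∈ Syz e φ d, w ∈ P) {w : ι → R4 k}
    (hw : φ w = 0) : w ∈ P :=
  mem_of_components e P w fun d =>
    h d _ (mem_syz.mpr ⟨mem_grF.mpr fun _ => gc_mem _ _ _, hφ w hw d⟩)

lemma sum_gc_mul [Fintype ι] {e : ι → ℕ} {e' : ℕ} {m : ι → R4 k} (hm : ∀ i, m i ∈ Gr k e' (e i))
    (d : ℕ) (u : ι → R4 k) : ∑ i, gc (e i) d (u i) * m i = gc e' d (∑ i, u i * m i) := by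
  rw [map_sum]
  exact Finset.sum_congr rfl fun i _ => (gc_mul_of_mem (hm i) d (u i)).symm

lemma linearCombination_gc [Fintype ι] {e : ι → ℕ} {e' : κ → ℕ} {m : ι → κ → R4 k}
    (hm : ∀ i, m i ∈ GrF k e' (e i)) (d : ℕ) (u : ι → R4 k) :
    Fintype.linearCombination (R4 k) m (fun i => gc (e i) d (u i)) =
      fun j => gc (e' j) d (Fintype.linearCombination (R4 k) m u j) := by
  funext j
  simp only [Fintype.linearCombination_apply, Finset.sum_apply, Pi.smul_apply, smul_eq_mul]
  exact sum_gc_mul (fun i => mem_grF.mp (hm i) j) d u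

lemma linearCombination_mem_grF [Fintype ι] {e : ι → ℕ} {e' : κ → ℕ} {m : ι → κ → R4 k}
    (hm : ∀ i, m i ∈ GrF k e' (e i)) {d : ℕ} {u : ι → R4 k} (hu : u ∈ GrF k e d) :
    Fintype.linearCombination (R4 k) m u ∈ GrF k e' d := by
  have h1 : u = fun i => gc (e i) d (u i) :=
    _root_.funext fun i => (gc_of_mem (mem_grF.mp hu i)).symm
  rw [h1, linearCombination_gc hm]
  exact mem_grF.mpr fun j => gc_mem _ _ _

/-- Minimal generators of a graded syzygy module generated in a single degree. -/
lemma exists_generators [Fintype ι] {e : ι → ℕ} {φ : (ι → R4 k) →ₗ[R4 k] M} {D n : ℕ}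
    (hlow : ∀ d < D, Syz e φ d = ⊥) (hrank : Module.finrank k (Syz e φ D) = n)
    (hK : ∀ d, D ≤ d → KEx (xv k) 4 (Syz e φ (d + 1)) (Syz e φ d) 0) :
    ∃ m : Fin n → ι → R4 k, (∀ i, m i ∈ Syz e φ D) ∧
      (∀ c : Fin n → k, ∑ i, c i • m i = 0 → c = 0) ∧
      ∀ d, ∀ w ∈ Syz e φ d, ∃ u ∈ GrF k (fun _ => D) d, Fintype.linearCombination (R4 k) m u = w := by
  have hfd : FiniteDimensional k (Syz e φ D) :=
    Submodule.finiteDimensional_of_le (S₂ := GrF k e D) inf_le_left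
  obtain ⟨m, hm, hind, hspan⟩ := exists_basis_mod (U := ⊥) (V := Syz e φ D) bot_le (n := n)
    (by rw [hrank, finrank_bot, zero_add])
  refine ⟨m, hm, fun c hc => hind c (by rw [hc]; exact Submodule.zero_mem _), ?_⟩
  have hmem : ∀ d, ∀ w ∈ Syz e φ d, w ∈ LinearMap.range (Fintype.linearCombination (R4 k) m) := by
    intro d
    rcases lt_or_ge d D with hd | hd
    · intro w hw
      rw [hlow d hd, Submodule.mem_bot] at hw
      rw [hw]
      exact Submodule.zero_mem _
    · induction d, hd using Nat.le_induction with
      | base =>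
        intro w hw
        obtain ⟨c, hc⟩ := hspan w hw
        refine ⟨fun i => C (c i), ?_⟩
        rw [Submodule.mem_bot, sub_eq_zero] at hc
        rw [hc, Fintype.linearCombination_apply]
        refine Finset.sum_congr rfl fun i _ => ?_
        funext j
        simp [C_mul']
      | succ d hd ih => exact (hK d hd).mem_of_forall_mem _ ih
  intro d w hw
  obtain ⟨u, hu⟩ := hmem d w hw
  refine ⟨fun i => gc D d (u i), mem_grF.mpr fun i => gc_mem _ _ _, ?_⟩
  rw [linearCombination_gc (fun i => (mem_syz.mp (hm i)).1), hu]
  exact _root_.funext fun j => gc_of_mem (mem_grF.mp (mem_syz.mp hw).1 j)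

lemma entryOk_of_mem_gr {e d : ℕ} (hne : e ≠ d) {p : R4 k} (hp : p ∈ Gr k e d) :
    EntryOk k d e p := by
  rcases lt_or_ge d e with h | h
  · rw [gr_of_lt h, Submodule.mem_bot] at hp
    subst hp
    exact ⟨Or.inl rfl, coeff_zero _⟩
  · rw [gr_of_le h] at hp
    refine ⟨Or.inr ⟨d - e, by omega, hp⟩, IsHomogeneous.coeff_eq_zero hp ?_⟩
    simp
    omega

lemma syz_eq_bot_of_succ {e : ι → ℕ} {φ : (ι → R4 k) →ₗ[R4 k] M} {d : ℕ}
    (h : Syz e φ (d + 1) = ⊥) : Syz e φ d = ⊥ := by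
  rw [eq_bot_iff]
  intro w hw
  have h1 : (X 0 : R4 k) • w ∈ Syz e φ (d + 1) := by
    refine mem_syz.mpr ⟨mem_grF.mpr fun j =>
      homogeneous_mul_mem_gr (isHomogeneous_X _ _) (mem_grF.mp hw.1 j), ?_⟩
    rw [map_smul, (mem_syz.mp hw).2, smul_zero]
  rw [h, Submodule.mem_bot] at h1
  rw [Submodule.mem_bot]
  funext j
  have := congrFun h1 j
  simpa [X_ne_zero] using this

lemma syz_eq_bot_of_le {e : ι → ℕ} {φ : (ι → R4 k) →ₗ[R4 k] M} {d d' : ℕ} (hd : d ≤ d')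
    (h : Syz e φ d' = ⊥) : Syz e φ d = ⊥ := by
  induction d', hd using Nat.le_induction with
  | base => exact h
  | succ d' _ ih => exact ih (syz_eq_bot_of_succ h)

lemma finrank_syz [Fintype ι] [Module k M] [IsScalarTower k (R4 k) M] {e : ι → ℕ}
    {φ : (ι → R4 k) →ₗ[R4 k] M} {d : ℕ} {N : Submodule k M} (hmap : ∀ y ∈ GrF k e d, φ y ∈ N)
    (hsurj : ∀ m ∈ N, ∃ y ∈ GrF k e d, φ y = m) :
    Module.finrank k N + Module.finrank k (Syz e φ d) = ∑ j, Module.finrank k (Gr k (e j) d) := by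
  let ψ : GrF k e d →ₗ[k] M := (φ.restrictScalars k).domRestrict (GrF k e d)
  have h1 : LinearMap.range ψ = N := by
    ext m
    constructor
    · rintro ⟨y, rfl⟩
      exact hmap _ y.2
    · intro hm
      obtain ⟨y, hy, rfl⟩ := hsurj m hm
      exact ⟨⟨y, hy⟩, rfl⟩
  have h2 : (LinearMap.ker ψ).map (Submodule.subtype _) = Syz e φ d := by
    ext p
    simp only [Submodule.mem_map, LinearMap.mem_ker, Submodule.coe_subtype, mem_syz]
    constructor
    · rintro ⟨q, hq, rfl⟩
      exact ⟨q.2, hq⟩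
    · rintro ⟨hp, hz⟩
      exact ⟨⟨p, hp⟩, hz, rfl⟩
  have h3 := ψ.finrank_range_add_finrank_ker
  have h4 := LinearEquiv.finrank_eq
    (Submodule.equivMapOfInjective _ (Submodule.subtype_injective _) (LinearMap.ker ψ))
  rw [h2] at h4
  rw [h1, finrank_grF] at h3
  rw [← h3, h4]

/-- Homogeneous relations in the degree of the generators are trivial. -/
lemma syz_eq_bot_of_independent [Fintype ι] {e : ι → ℕ} {m : ι → κ → R4 k} {D : ℕ}
    (he : ∀ i, e i = D) (hind : ∀ c : ι → k, ∑ i, c i • m i = 0 → c = 0) :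
    Syz e (Fintype.linearCombination (R4 k) m) D = ⊥ := by
  rw [eq_bot_iff]
  rintro w ⟨hw, hw0⟩
  have h1 : ∀ i, ∃ c : k, w i = C c := by
    intro i
    have := mem_grF.mp hw i
    rw [he, gr_of_le le_rfl, Nat.sub_self, homogeneousSubmodule_zero] at this
    obtain ⟨c, hc⟩ := Submodule.mem_one.mp this
    exact ⟨c, hc.symm⟩
  choose c hc using h1
  have := hind c (by
    have h2 : Fintype.linearCombination (R4 k) m w = 0 := hw0
    rw [← h2, Fintype.linearCombination_apply]
    refine Finset.sum_congr rfl fun i _ => ?_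
    funext j
    simp [hc, C_mul'])
  rw [Submodule.mem_bot]
  funext i
  rw [hc, this]
  simp

end Syzygies

section Resolution

variable {k : Type} [Field k]

/-- The conditions on a family of vectors on the cone over the cubic surface from which the
shape of the resolution follows: the vectors impose independent conditions on forms of degree
`a`, and the forms of degree `a` vanishing on them have no linear syzygies modulo `f`. -/
structure Good (f : R4 k) (a : ℕ) {ι : Type} [Fintype ι] (z : ι → Fin 4 → k) : Prop where
  ne_zero : ∀ i, z i ≠ 0
  vanish : ∀ i, eval (z i) f = 0
  indep : ∀ c : ι → k, (∀ q : R4 k, q.IsHomogeneous a → ∑ i, c i * eval (z i) q = 0) → c = 0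
  lift : ∀ q : Fin 4 → R4 k, (∀ i, q i ∈ Iz z a) → f ∣ ∑ i, X i * q i → ∀ i, f ∣ q i

variable {f : R4 k} {a : ℕ} {ι : Type} [Fintype ι] {z : ι → Fin 4 → k}

lemma Good.sep (h : Good f a z) {d : ℕ} (hd : a ≤ d) : Sep z d :=
  (sep_of_independent h.indep).mono h.ne_zero hd

lemma Good.fd_le (h : Good f a z) (d : ℕ) : Fd f d ≤ Iz z d := by
  intro p hp
  rw [mem_fd] at hp
  refine ⟨hp.1, fun i => ?_⟩
  obtain ⟨q, rfl⟩ := hp.2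
  rw [map_mul, h.vanish, zero_mul]

lemma eq_zero_of_dvd (hf : f.IsHomogeneous 3) {d : ℕ} (hd : d < 3) {p : R4 k}
    (hp : p.IsHomogeneous d) (h : f ∣ p) : p = 0 := by
  have : p ∈ Fd f d := mem_fd.mpr ⟨hp, h⟩
  rwa [fd_eq_bot hf hd, Submodule.mem_bot] at this

lemma not_dvd_X (hf : f.IsHomogeneous 3) (i : Fin 4) : ¬ f ∣ X i := fun h =>
  X_ne_zero i (eq_zero_of_dvd hf (by norm_num) (isHomogeneous_X _ i) h)

lemma Good.dvd_of_mem_iz (h : Good f a z) (hf : f.IsHomogeneous 3) (hp : Prime f) {d : ℕ}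
    (hd : d < a) {p : R4 k} (hpz : p ∈ Iz z d) : f ∣ p := by
  have hX : ∀ i, (X i * (X 0 ^ (a - 1 - d) * p)) ∈ Iz z a := by
    intro i
    refine ⟨?_, fun l => by simp [hpz.2 l]⟩
    have := (isHomogeneous_X k i).mul (((isHomogeneous_X k (0 : Fin 4)).pow (a - 1 - d)).mul hpz.1)
    convert! this using 1
    omega
  have h1 := h.lift ![X 1 * (X 0 ^ (a - 1 - d) * p), -(X 0 * (X 0 ^ (a - 1 - d) * p)), 0, 0]
    (fun i => by
      fin_cases i
      · exact hX 1
      · exact Submodule.neg_mem _ (hX 0)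
      · exact Submodule.zero_mem _
      · exact Submodule.zero_mem _)
    (by
      rw [Fin.sum_univ_four]
      simp only [Matrix.cons_val]
      convert! dvd_zero f using 1
      ring) 0
  rcases hp.dvd_or_dvd h1 with h2 | h2
  · exact absurd h2 (not_dvd_X hf 1)
  rcases hp.dvd_or_dvd h2 with h2 | h2
  · exact absurd (hp.dvd_of_dvd_pow h2) (not_dvd_X hf 0)
  · exact h2

lemma Good.finrank_iz (h : Good f a z) (hf : f.IsHomogeneous 3) (h0 : f ≠ 0)
    (hcard : 2 * Fintype.card ι = 3 * a * a + a + 2) {d : ℕ} (hd : a ≤ d) :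
    2 * Module.finrank k (Iz z d) + 3 * a * a + a =
      2 * Module.finrank k (Fd f d) + 3 * d * (d + 1) := by
  have h1 := (h.sep hd).finrank
  have h2 := two_mul_finrank_homogeneousSubmodule hf h0 d
  linarith

/-- Degrees of the generators of the ideal of the points. -/
def genDeg (a : ℕ) : Fin (a + 3 + 1) → ℕ :=
  Fin.append (Fin.append (fun _ : Fin a => a) (fun _ : Fin 3 => a + 1)) (fun _ : Fin 1 => 3)

lemma sum_genDeg {M : Type*} [AddCommMonoid M] (F : Fin (a + 3 + 1) → M) :
    ∑ j, F j = ∑ j : Fin a, F (Fin.castAdd 1 (Fin.castAdd 3 j)) +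
      ∑ j : Fin 3, F (Fin.castAdd 1 (Fin.natAdd a j)) + F (Fin.natAdd (a + 3) 0) := by
  rw [Fin.sum_univ_add, Fin.sum_univ_add]
  simp

lemma genDeg_left (j : Fin a) : genDeg a (Fin.castAdd 1 (Fin.castAdd 3 j)) = a := by
  simp [genDeg]

lemma genDeg_mid (j : Fin 3) : genDeg a (Fin.castAdd 1 (Fin.natAdd a j)) = a + 1 := by
  simp [genDeg]

lemma genDeg_right : genDeg a (Fin.natAdd (a + 3) (0 : Fin 1)) = 3 := by
  simp [genDeg, Fin.append_right]

lemma forall_genDeg {P : Fin (a + 3 + 1) → Prop}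
    (h1 : ∀ j : Fin a, P (Fin.castAdd 1 (Fin.castAdd 3 j)))
    (h2 : ∀ j : Fin 3, P (Fin.castAdd 1 (Fin.natAdd a j))) (h3 : P (Fin.natAdd (a + 3) 0)) :
    ∀ j, P j := by
  intro j
  refine Fin.addCases (fun j => ?_) (fun j => ?_) j
  · exact Fin.addCases h1 h2 j
  · rw [Subsingleton.elim j 0]
    exact h3

/-- A basis of the forms of degree `a` through the points, modulo `f`. -/
lemma Good.exists_basis (h : Good f a z) (hf : f.IsHomogeneous 3) (h0 : f ≠ 0)
    (hcard : 2 * Fintype.card ι = 3 * a * a + a + 2) :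
    ∃ g : Fin a → R4 k, (∀ j, g j ∈ Iz z a) ∧
      (∀ c : Fin a → k, ∑ j, c j • g j ∈ Fd f a → c = 0) ∧
      ∀ v ∈ Iz z a, ∃ c : Fin a → k, v - ∑ j, c j • g j ∈ Fd f a :=
  exists_basis_mod (h.fd_le a) (by linarith [h.finrank_iz hf h0 hcard le_rfl])

/-- The linear form with the given coefficients. -/
noncomputable def lin : (Fin 4 → k) →ₗ[k] R4 k := Fintype.linearCombination k X

lemma lin_apply (l : Fin 4 → k) : lin l = ∑ i, l i • (X i : R4 k) :=
  Fintype.linearCombination_apply k _ l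

lemma eval_lin (l v : Fin 4 → k) : eval v (lin l) = l ⬝ᵥ v := by
  simp [lin_apply, dotProduct, smul_eval]

lemma lin_isHomogeneous (l : Fin 4 → k) : (lin l).IsHomogeneous 1 := by
  rw [lin_apply]
  exact Submodule.sum_mem (homogeneousSubmodule (Fin 4) k 1) fun i _ =>
    Submodule.smul_mem _ _ (isHomogeneous_X k i)

lemma exists_eq_lin {p : R4 k} (hp : p.IsHomogeneous 1) : ∃ c : Fin 4 → k, p = lin c := by
  have : p ∈ homogeneousSubmodule (Fin 4) k 1 := hp
  rw [homogeneousSubmodule_one_eq_span_X, Submodule.mem_span_range_iff_exists_fun] at this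
  obtain ⟨c, hc⟩ := this
  exact ⟨c, by rw [lin_apply, hc]⟩

lemma Good.linear_relations_trivial (h : Good f a z) {n : ℕ} {g : Fin n → R4 k}
    (hg : ∀ j, g j ∈ Iz z a) (hgi : ∀ c : Fin n → k, ∑ j, c j • g j ∈ Fd f a → c = 0)
    {l : Fin n → Fin 4 → k} (hl : f ∣ ∑ j, lin (l j) * g j) : l = 0 := by
  have h1 := h.lift (fun i => ∑ j, l j i • g j)
    (fun i => Submodule.sum_mem _ fun j _ => Submodule.smul_mem _ _ (hg j)) (by
      convert! hl using 1
      simp_rw [lin_apply, Finset.sum_mul, Finset.mul_sum]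
      rw [Finset.sum_comm]
      refine Finset.sum_congr rfl fun j _ => Finset.sum_congr rfl fun i _ => ?_
      rw [mul_smul_comm, smul_mul_assoc])
  funext j i
  refine congrFun (hgi (fun j => l j i) (mem_fd.mpr ⟨?_, h1 i⟩)) j
  exact Submodule.sum_mem (homogeneousSubmodule (Fin 4) k a) fun j _ =>
    Submodule.smul_mem _ _ (hg j).1

section LinMul

variable {H : Type} [AddCommGroup H] [Module k H] {n : ℕ}

/-- Linear combinations of the forms `g` with coefficients in a space of linear forms, modulo
the multiples of `f`. -/
noncomputable def linMul (f : R4 k) (a : ℕ) (g : Fin n → R4 k) (θ : H →ₗ[k] (Fin 4 → k)) :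
    ((Fin n → H) × Fd f (a + 1)) →ₗ[k] R4 k where
  toFun x := ∑ j, lin (θ (x.1 j)) * g j + x.2
  map_add' x y := by
    simp only [Prod.fst_add, Pi.add_apply, map_add, Finset.sum_add_distrib, add_mul,
      Prod.snd_add, Submodule.coe_add]
    ring
  map_smul' c x := by
    simp only [Prod.smul_fst, Pi.smul_apply, map_smul, smul_mul_assoc, ← Finset.smul_sum,
      Prod.smul_snd, Submodule.coe_smul, smul_add, RingHom.id_apply]

lemma linMul_apply (g : Fin n → R4 k) (θ : H →ₗ[k] (Fin 4 → k))
    (x : (Fin n → H) × Fd f (a + 1)) :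
    linMul f a g θ x = ∑ j, lin (θ (x.1 j)) * g j + x.2 := rfl

variable {g : Fin n → R4 k} {θ : H →ₗ[k] (Fin 4 → k)}

lemma Good.range_linMul_le (h : Good f a z) (hg : ∀ j, g j ∈ Iz z a) :
    LinearMap.range (linMul f a g θ) ≤ Iz z (a + 1) := by
  rintro _ ⟨x, rfl⟩
  refine Submodule.add_mem _ (Submodule.sum_mem _ fun j _ => ⟨?_, fun i => ?_⟩)
    (h.fd_le _ x.2.2)
  · rw [mul_comm]
    exact (hg j).1.mul (lin_isHomogeneous _)
  · rw [map_mul, (hg j).2, mul_zero]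

lemma Good.finrank_range_linMul (h : Good f a z) (hg : ∀ j, g j ∈ Iz z a)
    (hgi : ∀ c : Fin n → k, ∑ j, c j • g j ∈ Fd f a → c = 0) [FiniteDimensional k H]
    (hθ : Function.Injective θ) :
    Module.finrank k (LinearMap.range (linMul f a g θ)) =
      n * Module.finrank k H + Module.finrank k (Fd f (a + 1)) := by
  have hinj : Function.Injective (linMul f a g θ) := by
    rw [injective_iff_map_eq_zero]
    rintro ⟨l, r⟩ hx
    rw [linMul_apply] at hx
    have hl : (fun j => θ (l j)) = 0 := h.linear_relations_trivial hg hgi (by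
      rw [eq_neg_of_add_eq_zero_left hx, dvd_neg]
      exact (mem_fd.mp r.2).2)
    have hl : l = 0 := by
      funext j
      exact hθ (by rw [congrFun hl j]; simp)
    subst hl
    simpa using hx
  rw [LinearMap.finrank_range_of_inj hinj, Module.finrank_prod, Module.finrank_pi_fintype]
  simp

end LinMul

/-- Generators of the ideal of the points with no relations in degree `a + 1`. -/
lemma Good.exists_ideal_generators (h : Good f a z) (hf : f.IsHomogeneous 3) (hp : Prime f)
    (hcard : 2 * Fintype.card ι = 3 * a * a + a + 2) (ha : 3 ≤ a) :
    ∃ g : Fin (a + 3 + 1) → R4 k, (∀ j, g j ∈ Iz z (genDeg a j)) ∧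
      (∀ d, ∀ x ∈ Iz z d, x ∈ LinearMap.range (Fintype.linearCombination (R4 k) g)) ∧
      Syz (genDeg a) (Fintype.linearCombination (R4 k) g) (a + 1) = ⊥ := by
  obtain ⟨g, hg, hgi, hgs⟩ := h.exists_basis hf hp.ne_zero hcard
  have hLrank := h.finrank_range_linMul hg hgi (θ := LinearMap.id) Function.injective_id
  rw [Module.finrank_fin_fun] at hLrank
  obtain ⟨g', hg', hgi', hgs'⟩ := exists_basis_mod
    (h.range_linMul_le hg (θ := LinearMap.id)) (n := 3)
    (by linarith [h.finrank_iz hf hp.ne_zero hcard (Nat.le_succ a)])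
  let G : Fin (a + 3 + 1) → R4 k := Fin.append (Fin.append g g') (fun _ : Fin 1 => f)
  have hG1 : ∀ j, G (Fin.castAdd 1 (Fin.castAdd 3 j)) = g j := fun j => by simp [G]
  have hG2 : ∀ j, G (Fin.castAdd 1 (Fin.natAdd a j)) = g' j := fun j => by simp [G]
  have hG3 : G (Fin.natAdd (a + 3) 0) = f := by simp [G, Fin.append_right]
  have hGmem : ∀ j, G j ∈ LinearMap.range (Fintype.linearCombination (R4 k) G) := by
    classical
    intro j
    exact ⟨Pi.single j 1, by simp⟩
  have hfmem : ∀ q, f ∣ q → q ∈ LinearMap.range (Fintype.linearCombination (R4 k) G) := by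
    rintro _ ⟨q, rfl⟩
    rw [mul_comm, ← hG3]
    exact Submodule.smul_mem _ q (hGmem _)
  have hgmem : ∀ j, g j ∈ LinearMap.range (Fintype.linearCombination (R4 k) G) := fun j =>
    hG1 j ▸ hGmem _
  refine ⟨G, forall_genDeg (fun j => ?_) (fun j => ?_) ?_, fun d => ?_, ?_⟩
  · rw [hG1, genDeg_left]; exact hg j
  · rw [hG2, genDeg_mid]; exact hg' j
  · rw [hG3, genDeg_right]; exact ⟨hf, h.vanish⟩
  · rcases lt_or_ge d a with hd | hd
    · exact fun x hx => hfmem x (h.dvd_of_mem_iz hf hp hd hx)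
    rcases hd.eq_or_lt with rfl | hd
    · intro x hx
      obtain ⟨c, hc⟩ := hgs x hx
      rw [← sub_add_cancel x (∑ j, c j • g j)]
      refine Submodule.add_mem _ (hfmem _ (mem_fd.mp hc).2) (Submodule.sum_mem _ fun j _ => ?_)
      rw [← C_mul']
      exact Submodule.smul_mem _ _ (hgmem j)
    · induction d, (hd : a + 1 ≤ d) using Nat.le_induction with
      | base =>
        intro x hx
        obtain ⟨c, y, hc⟩ := hgs' x hx
        rw [← sub_add_cancel x (∑ j, c j • g' j), ← hc]
        refine Submodule.add_mem _ (Submodule.add_mem _ (Submodule.sum_mem _ fun j _ => ?_)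
          (hfmem _ (mem_fd.mp y.2.2).2)) (Submodule.sum_mem _ fun j _ => ?_)
        · exact Submodule.smul_mem _ _ (hgmem j)
        · rw [← C_mul', ← hG2]
          exact Submodule.smul_mem _ _ (hGmem _)
      | succ d hd ih =>
        refine (kEx_iz h.ne_zero d 0 (Or.inr ⟨d - 1, by omega, h.sep (by omega)⟩)).mem_of_forall_mem
          _ (ih (by omega))
  · rw [eq_bot_iff]
    rintro w ⟨hw, hw0⟩
    have hw0 : Fintype.linearCombination (R4 k) G w = 0 := hw0
    rw [Fintype.linearCombination_apply, sum_genDeg] at hw0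
    simp only [hG1, hG2, hG3, smul_eq_mul] at hw0
    have hw := mem_grF.mp hw
    have hw2 : ∀ j, ∃ c : k, w (Fin.castAdd 1 (Fin.natAdd a j)) = C c := by
      intro j
      have := hw (Fin.castAdd 1 (Fin.natAdd a j))
      rw [genDeg_mid, gr_of_le le_rfl, Nat.sub_self, homogeneousSubmodule_zero] at this
      obtain ⟨c, hc⟩ := Submodule.mem_one.mp this
      exact ⟨c, hc.symm⟩
    choose c hc using hw2
    have hw1 : ∀ j, ∃ l : Fin 4 → k, w (Fin.castAdd 1 (Fin.castAdd 3 j)) = lin l := by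
      intro j
      have := hw (Fin.castAdd 1 (Fin.castAdd 3 j))
      rw [genDeg_left, gr_of_le (show a ≤ a + 1 by omega), Nat.add_sub_cancel_left] at this
      exact exists_eq_lin this
    choose l hl using hw1
    have hw3 : w (Fin.natAdd (a + 3) 0) * f ∈ Fd f (a + 1) := by
      rw [mem_fd_iff_exists hf]
      have := hw (Fin.natAdd (a + 3) 0)
      rw [genDeg_right] at this
      exact ⟨_, this, rfl⟩
    simp only [hc, hl, C_mul'] at hw0
    have hc0 : c = 0 := by
      refine hgi' c ⟨(-l, -⟨_, hw3⟩), ?_⟩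
      rw [linMul_apply]
      simp only [Pi.neg_apply, map_neg, Finset.sum_neg_distrib, neg_mul, LinearMap.id_apply,
        Submodule.coe_neg]
      linear_combination -hw0
    subst hc0
    simp only [Pi.zero_apply, zero_smul, Finset.sum_const_zero, add_zero] at hw0
    have hl0 : l = 0 := h.linear_relations_trivial hg hgi (by
      rw [eq_neg_of_add_eq_zero_left hw0, dvd_neg]
      exact Dvd.intro_left _ rfl)
    subst hl0
    simp only [Pi.zero_apply, map_zero, Finset.sum_const_zero, zero_mul, zero_add] at hw0 hl
    rw [Submodule.mem_bot]
    funext j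
    refine forall_genDeg (P := fun j => w j = 0) hl (fun j => ?_) ?_ j
    · rw [hc]; simp
    · exact (mul_eq_zero.mp hw0).resolve_right hp.ne_zero

end Resolution

section Ungrading

variable {k : Type} [Field k]

lemma eval_smul_of_isHomogeneous {σ : Type*} {p : MvPolynomial σ k} {d : ℕ} (hp : p.IsHomogeneous d)
    (c : k) (v : σ → k) : eval (c • v) p = c ^ d * eval v p := by
  rw [eval_eq, eval_eq, Finset.mul_sum]
  refine Finset.sum_congr rfl fun m hm => ?_
  have hd : ∑ i ∈ m.support, m i = d := by
    have := hp (mem_support_iff.mp hm)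
    rwa [Finsupp.weight_apply, Finsupp.sum, Finset.sum_congr rfl fun i _ => by
      rw [Pi.one_apply, smul_eq_mul, mul_one]] at this
  simp only [Pi.smul_apply, smul_eq_mul, mul_pow, Finset.prod_mul_distrib]
  rw [Finset.prod_pow_eq_pow_sum, hd]
  ring

/-- A polynomial vanishing on a punctured line through the origin vanishes there componentwise. -/
lemma eval_homogeneousComponent_eq_zero [Infinite k] {σ : Type*} {p : MvPolynomial σ k} {v : σ → k}
    (h : ∀ c : k, c ≠ 0 → eval (c • v) p = 0) (d : ℕ) :
    eval v (homogeneousComponent d p) = 0 := by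
  let P : Polynomial k := ∑ d ∈ Finset.range (p.totalDegree + 1),
    Polynomial.monomial d (eval v (homogeneousComponent d p))
  have hP : ∀ c, P.eval c = eval (c • v) p := by
    intro c
    conv_rhs => rw [← sum_homogeneousComponent p]
    rw [map_sum, Polynomial.eval_finsetSum]
    refine Finset.sum_congr rfl fun d _ => ?_
    rw [Polynomial.eval_monomial,
      eval_smul_of_isHomogeneous (homogeneousComponent_isHomogeneous d p), mul_comm]
  have h0 : P = 0 := by
    refine Polynomial.eq_zero_of_infinite_isRoot P
      (((Set.finite_singleton (0 : k)).infinite_compl).mono fun c hc => ?_)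
    change P.eval c = 0
    rw [hP]
    exact h c hc
  by_cases hd : d ∈ Finset.range (p.totalDegree + 1)
  · have := congrArg (fun q => Polynomial.coeff q d) h0
    simpa [P, Polynomial.finsetSum_coeff, Polynomial.coeff_monomial, hd,
      -Finset.mem_range] using this
  · rw [homogeneousComponent_eq_zero _ _ (by simpa using hd), map_zero]

lemma iz_le_pointsIdeal {t d : ℕ} {Z : Fin t → P3 k} {z : Fin t → Fin 4 → k}
    (hz : ∀ i, ∃ hv : z i ≠ 0, Projectivization.mk k (z i) hv = Z i) {p : R4 k} (hp : p ∈ Iz z d) :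
    p ∈ pointsIdeal k (Set.range Z) := by
  rintro _ ⟨i, rfl⟩ v hv hmk
  obtain ⟨h0, hi⟩ := hz i
  rw [← hi, Projectivization.mk_eq_mk_iff'] at hmk
  obtain ⟨c, rfl⟩ := hmk
  rw [eval_smul_of_isHomogeneous hp.1, hp.2, mul_zero]

lemma homogeneousComponent_mem_iz [Infinite k] {t : ℕ} {Z : Fin t → P3 k} {z : Fin t → Fin 4 → k}
    (hz : ∀ i, ∃ hv : z i ≠ 0, Projectivization.mk k (z i) hv = Z i) {p : R4 k}
    (hp : p ∈ pointsIdeal k (Set.range Z)) (d : ℕ) : homogeneousComponent d p ∈ Iz z d := by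
  refine ⟨homogeneousComponent_isHomogeneous d p, fun i => ?_⟩
  obtain ⟨h0, hi⟩ := hz i
  refine eval_homogeneousComponent_eq_zero (fun c hc => ?_) d
  refine hp _ ⟨i, rfl⟩ (c • z i) (smul_ne_zero hc h0) ?_
  rw [← hi, Projectivization.mk_eq_mk_iff']
  exact ⟨c, rfl⟩

variable {ι κ : Type} {M : Type*} [AddCommGroup M] [Module (R4 k) M]

lemma map_linearCombination_eq_zero [Fintype ι] {m : ι → κ → R4 k} {φ : (κ → R4 k) →ₗ[R4 k] M}
    (hm : ∀ i, φ (m i) = 0) (u : ι → R4 k) : φ (Fintype.linearCombination (R4 k) m u) = 0 := by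
  rw [Fintype.linearCombination_apply, map_sum]
  exact Finset.sum_eq_zero fun i _ => by rw [map_smul, hm, smul_zero]

lemma linearCombination_mem_syz [Fintype ι] {e : ι → ℕ} {e' : κ → ℕ} {m : ι → κ → R4 k}
    {φ : (κ → R4 k) →ₗ[R4 k] M} (hm : ∀ i, m i ∈ Syz e' φ (e i)) {d : ℕ} {u : ι → R4 k}
    (hu : u ∈ GrF k e d) : Fintype.linearCombination (R4 k) m u ∈ Syz e' φ d := by
  refine mem_syz.mpr ⟨linearCombination_mem_grF (fun i => (mem_syz.mp (hm i)).1) hu, ?_⟩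
  exact map_linearCombination_eq_zero (fun i => (mem_syz.mp (hm i)).2) u

lemma linearCombination_mem_iz [Fintype κ] {t : Type} {z : t → Fin 4 → k} {e : κ → ℕ}
    {g : κ → R4 k} (hg : ∀ j, g j ∈ Iz z (e j)) {d : ℕ} {u : κ → R4 k} (hu : u ∈ GrF k e d) :
    Fintype.linearCombination (R4 k) g u ∈ Iz z d := by
  refine ⟨?_, fun i => ?_⟩
  · rw [Fintype.linearCombination_apply]
    refine Submodule.sum_mem (homogeneousSubmodule (Fin 4) k d) fun j _ => ?_
    have := mul_mem_gr (d1 := 0) (by rw [gr_zero]; exact (hg j).1) (mem_grF.mp hu j)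
    rwa [gr_zero] at this
  · rw [Fintype.linearCombination_apply, map_sum]
    refine Finset.sum_eq_zero fun j _ => ?_
    rw [smul_eq_mul, map_mul, (hg j).2, mul_zero]

lemma finrank_gr_of_add {e d c n : ℕ} (h : d = e + c) (hn : (c + 3).choose 3 = n) :
    Module.finrank k (Gr k e d) = n := by
  subst h
  rw [gr_of_le (Nat.le_add_right e c), Nat.add_sub_cancel_left, finrank_homogeneousSubmodule,
    ← hn, Nat.choose_symm_add]

end Ungrading

section Resolution

variable {k : Type} [Field k] {f : R4 k} {a : ℕ}

/-- The shape of the minimal free resolution of a good family of points. -/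
theorem Good.hasMinFreeRes3 [Infinite k] {t : ℕ} {Z : Fin t → P3 k} {z : Fin t → Fin 4 → k}
    (hz : ∀ i, ∃ hv : z i ≠ 0, Projectivization.mk k (z i) hv = Z i) (h : Good f a z)
    (hf : f.IsHomogeneous 3) (hp : Prime f) (hcard : 2 * t = 3 * a * a + a + 2) (ha : 3 ≤ a) :
    HasMinFreeRes3 k ⊥ (pointsIdeal k (Set.range Z)) (genDeg a)
      (fun _ : Fin (3 * a + 3) => a + 2) (fun _ : Fin (2 * a) => a + 3) := by
  have hcard : 2 * Fintype.card (Fin t) = 3 * a * a + a + 2 := by rwa [Fintype.card_fin]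
  obtain ⟨g, hg, hgr, hg1⟩ := h.exists_ideal_generators hf hp hcard ha
  have hg0 : ∀ j, g j ∈ Gr k 0 (genDeg a j) := fun j => by rw [gr_zero]; exact (hg j).1
  set φ := Fintype.linearCombination (R4 k) g with hφ
  have hmap1 : ∀ d, ∀ y ∈ GrF k (genDeg a) d, φ y ∈ Iz z d := fun d y hy =>
    linearCombination_mem_iz hg hy
  have hsurj1 : ∀ d, ∀ x ∈ Iz z d, ∃ y ∈ GrF k (genDeg a) d, φ y = x := by
    intro d x hx
    obtain ⟨w, hw⟩ := hgr d x hx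
    refine ⟨fun j => gc (genDeg a j) d (w j), mem_grF.mpr fun j => gc_mem _ _ _, ?_⟩
    rw [hφ, Fintype.linearCombination_apply] at hw ⊢
    simp only [smul_eq_mul] at hw ⊢
    rw [sum_gc_mul hg0, hw]
    exact gc_of_mem (by rw [gr_zero]; exact hx.1)
  have hdeg : ∀ j, genDeg a j ≤ a + 1 :=
    forall_genDeg (fun j => by rw [genDeg_left]; omega) (fun j => by rw [genDeg_mid])
      (by rw [genDeg_right]; omega)
  have hI : ∀ d i, a + 1 ≤ d ∨ 3 ≤ i → KEx (xv k) 4 (Iz z (d + 1)) (Iz z d) i := by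
    intro d i hd
    refine kEx_iz h.ne_zero d i (hd.elim (fun hd => Or.inr ⟨d - 1, by omega, h.sep (by omega)⟩)
      Or.inl)
  have hS1 : ∀ d i, a + 1 ≤ d ∨ 2 ≤ i →
      KEx (xv k) 4 (Syz (genDeg a) φ (d + 2)) (Syz (genDeg a) φ (d + 1)) i := fun d i hd =>
    kEx_syz hmap1 (hsurj1 d) (hI d (i + 1) (by omega)) fun hi j => by
      have := hdeg j
      omega
  have hrank1 : ∀ d, a + 2 ≤ d → Module.finrank k (Iz z d) +
      Module.finrank k (Syz (genDeg a) φ d) = a * Module.finrank k (Gr k a d) +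
        3 * Module.finrank k (Gr k (a + 1) d) + Module.finrank k (Gr k 3 d) := by
    intro d hd
    rw [finrank_syz (hmap1 d) (hsurj1 d), sum_genDeg]
    have hsub : ∀ j e, genDeg a j = e → Module.finrank k (Gr k (genDeg a j) d) =
        Module.finrank k (Gr k e d) := fun j e he => by rw [he]
    rw [hsub _ _ genDeg_right, Finset.sum_congr rfl fun j _ => hsub _ _ (genDeg_left j),
      Finset.sum_congr rfl fun j _ => hsub _ _ (genDeg_mid j)]
    simp
  have hr0 : ∀ e, Module.finrank k (Gr k e e) = 1 := fun e =>
    finrank_gr_of_add (c := 0) rfl (by decide)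
  have hr1 : ∀ e, Module.finrank k (Gr k e (e + 1)) = 4 := fun e => finrank_gr_of_add rfl (by decide)
  have hr2 : ∀ e, Module.finrank k (Gr k e (e + 2)) = 10 := fun e =>
    finrank_gr_of_add rfl (by decide)
  have hr3 : ∀ e, Module.finrank k (Gr k e (e + 3)) = 20 := fun e =>
    finrank_gr_of_add rfl (by decide)
  have hSa2 : Module.finrank k (Syz (genDeg a) φ (a + 2)) = 3 * a + 3 := by
    have h1 := hrank1 (a + 2) le_rfl
    have h2 := h.finrank_iz hf hp.ne_zero hcard (show a ≤ a + 2 by omega)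
    rw [finrank_fd hf hp.ne_zero] at h2
    rw [hr2 a, hr1 (a + 1)] at h1
    linarith
  have hSa3 : Module.finrank k (Syz (genDeg a) φ (a + 3)) = 10 * a + 12 := by
    have h1 := hrank1 (a + 3) (by omega)
    have h2 := h.finrank_iz hf hp.ne_zero hcard (show a ≤ a + 3 by omega)
    rw [finrank_fd hf hp.ne_zero] at h2
    rw [hr3 a, hr2 (a + 1)] at h1
    linarith
  obtain ⟨m, hm, hmi, hms⟩ := MRC.exists_generators (D := a + 2)
    (fun d hd => syz_eq_bot_of_le (show d ≤ a + 1 by omega) hg1) hSa2 (fun d hd => by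
      obtain ⟨d, rfl⟩ := Nat.exists_eq_add_of_le' (show 1 ≤ d by omega)
      exact hS1 d 0 (by omega))
  set ψ := Fintype.linearCombination (R4 k) m with hψ
  have hmap2 : ∀ d, ∀ y ∈ GrF k (fun _ : Fin (3 * a + 3) => a + 2) d, ψ y ∈ Syz (genDeg a) φ d :=
    fun d y hy => linearCombination_mem_syz hm hy
  have hS2 : ∀ d i, 1 ≤ d → a + 2 ≤ d ∨ 1 ≤ i → KEx (xv k) 4 (Syz (fun _ => a + 2) ψ (d + 2))
      (Syz (fun _ => a + 2) ψ (d + 1)) i := by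
    intro d i hd0 hd
    obtain ⟨d, rfl⟩ := Nat.exists_eq_add_of_le' (show 1 ≤ d by omega)
    exact kEx_syz (N := Syz (genDeg a) φ) hmap2 (hms (d + 1)) (hS1 d (i + 1) (by omega))
      fun hi j => by omega
  have hb2 : Syz (fun _ : Fin (3 * a + 3) => a + 2) ψ (a + 2) = ⊥ :=
    syz_eq_bot_of_independent (fun _ => rfl) hmi
  have hSb3 : Module.finrank k (Syz (fun _ : Fin (3 * a + 3) => a + 2) ψ (a + 3)) = 2 * a := by
    have := finrank_syz (hmap2 (a + 3)) (hms (a + 3))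
    rw [hSa3] at this
    simp only [Finset.sum_const, Finset.card_univ, Fintype.card_fin, smul_eq_mul, hr1 (a + 2)]
      at this
    omega
  obtain ⟨n, hn, hni, hns⟩ := MRC.exists_generators (D := a + 3)
    (fun d hd => syz_eq_bot_of_le (show d ≤ a + 2 by omega) hb2) hSb3 (fun d hd => by
      obtain ⟨d, rfl⟩ := Nat.exists_eq_add_of_le' (show 1 ≤ d by omega)
      exact hS2 d 0 (by omega) (by omega))
  set χ := Fintype.linearCombination (R4 k) n with hχ
  have hb3 : ∀ d, Syz (fun _ : Fin (2 * a) => a + 3) χ d = ⊥ := by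
    intro d
    have hb : Syz (fun _ : Fin (2 * a) => a + 3) χ (a + 3) = ⊥ :=
      syz_eq_bot_of_independent (fun _ => rfl) hni
    rcases le_total d (a + 3) with hd | hd
    · exact syz_eq_bot_of_le hd hb
    induction d, hd using Nat.le_induction with
    | base => exact hb
    | succ d hd ih =>
      obtain ⟨d, rfl⟩ := Nat.exists_eq_add_of_le' (show 2 ≤ d by omega)
      have hK : KEx (xv k) 4 (Syz (fun _ : Fin (2 * a) => a + 3) χ (d + 3))
          (Syz (fun _ => a + 3) χ (d + 2)) 0 :=
        kEx_syz (N := Syz (fun _ => a + 2) ψ)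
          (fun d y hy => linearCombination_mem_syz hn hy) (hns (d + 1)) (hS2 d 1 (by omega) (by omega))
          fun hi j => by omega
      rw [eq_bot_iff]
      exact fun w hw => hK.mem_of_forall_mem ⊥ (fun w hw => by rwa [ih] at hw) w hw
  have hφ0 : ∀ w, φ w = 0 → ∀ d, φ (fun j => gc (genDeg a j) d (w j)) = 0 := by
    intro w hw d
    rw [hφ, Fintype.linearCombination_apply] at hw ⊢
    simp only [smul_eq_mul] at hw ⊢
    rw [sum_gc_mul hg0, hw, map_zero]
  have hψ0 : ∀ w, ψ w = 0 → ∀ d, ψ (fun j => gc (a + 2) d (w j)) = 0 := by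
    intro w hw d
    rw [hψ, linearCombination_gc (fun i => (mem_syz.mp (hm i)).1), ← hψ, hw]
    exact _root_.funext fun j => map_zero _
  have hχ0 : ∀ w, χ w = 0 → ∀ d, χ (fun j => gc (a + 3) d (w j)) = 0 := by
    intro w hw d
    rw [hχ, linearCombination_gc (fun i => (mem_syz.mp (hn i)).1), ← hχ, hw]
    exact _root_.funext fun j => map_zero _
  have hφe : ∀ w : Fin (a + 3 + 1) → R4 k, ∑ j, w j * g j = φ w := fun w => by
    simp [hφ, Fintype.linearCombination_apply]
  have hψe : ∀ u : Fin (3 * a + 3) → R4 k, (fun j => ∑ i, u i * m i j) = ψ u := fun u => by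
    funext j
    simp [hψ, Fintype.linearCombination_apply]
  have hχe : ∀ u : Fin (2 * a) → R4 k, (fun j => ∑ i, u i * n i j) = χ u := fun u => by
    funext j
    simp [hχ, Fintype.linearCombination_apply]
  refine ⟨g, m, n, fun j => ⟨iz_le_pointsIdeal hz (hg j), (hg j).1⟩, fun x hx => ?_,
    fun i j => entryOk_of_mem_gr ((Nat.lt_succ_of_le (hdeg j)).ne) (mem_grF.mp (hm i).1 j),
    fun i j => entryOk_of_mem_gr (Nat.succ_ne_self (a + 2)).symm (mem_grF.mp (hn i).1 j),
    fun w => ⟨fun hw => ?_, ?_⟩, fun u => ⟨fun hu => ?_, ?_⟩, fun v hv => ?_⟩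
  · have hx' : x ∈ LinearMap.range φ := by
      rw [← sum_homogeneousComponent x]
      exact Submodule.sum_mem _ fun d _ => hgr d _ (homogeneousComponent_mem_iz hz hx d)
    obtain ⟨w, rfl⟩ := hx'
    exact ⟨w, by rw [hφe, sub_self]; exact Submodule.zero_mem _⟩
  · rw [Ideal.mem_bot, hφe] at hw
    obtain ⟨u, hu⟩ := mem_of_forall_syz_mem hφ0 (P := LinearMap.range ψ)
      (fun d w hw => by
        obtain ⟨u, -, hu⟩ := hms d w hw
        exact ⟨u, hu⟩) hw
    exact ⟨u, fun j => by rw [← hu, ← hψe]⟩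
  · rintro ⟨u, hu⟩
    have hw : w = ψ u := by rw [← hψe]; exact _root_.funext hu
    rw [Ideal.mem_bot, hφe, hw]
    exact map_linearCombination_eq_zero (fun i => (mem_syz.mp (hm i)).2) u
  · have hu : ψ u = 0 := by rw [← hψe]; exact _root_.funext hu
    obtain ⟨v, hv⟩ := mem_of_forall_syz_mem hψ0 (P := LinearMap.range χ)
      (fun d w hw => by
        obtain ⟨u, -, hu⟩ := hns d w hw
        exact ⟨u, hu⟩) hu
    exact ⟨v, fun j => by rw [← hv, ← hχe]⟩
  · rintro ⟨v, hv⟩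
    have hu : u = χ v := by rw [← hχe]; exact _root_.funext hv
    have h1 : ψ u = 0 := by
      rw [hu]
      exact map_linearCombination_eq_zero (fun i => (mem_syz.mp (hn i)).2) v
    rw [← hψe] at h1
    exact congrFun h1
  · have hv : χ v = 0 := by rw [← hχe]; exact _root_.funext hv
    have := mem_of_forall_syz_mem hχ0 (P := ⊥)
      (fun d w hw => by rwa [hb3, Submodule.mem_bot] at hw) hv
    exact this

end Resolution

section Retraction

variable {k : Type} [Field k] {f : R4 k}

/-- Composition of polynomials with the projection to the hyperplane `η` along the vector `e`. -/
noncomputable def ret (η e : Fin 4 → k) : R4 k →ₐ[k] R4 k :=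
  aeval fun i => X i - C (e i) * lin η

variable {η e : Fin 4 → k}

lemma eval_ret (p : R4 k) (v : Fin 4 → k) : eval v (ret η e p) = eval (v - (η ⬝ᵥ v) • e) p := by
  induction p using MvPolynomial.induction_on with
  | C c => simp [ret]
  | add p q hp hq => rw [map_add, map_add, hp, hq, map_add]
  | mul_X p i hp =>
    have h1 : ret η e (X i) = X i - C (e i) * lin η := by simp [ret]
    rw [map_mul, map_mul, hp, h1, map_mul]
    simp [eval_lin, mul_comm]

lemma dvd_sub_ret (p : R4 k) : lin η ∣ p - ret η e p := by
  induction p using MvPolynomial.induction_on with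
  | C c => simp [ret]
  | add p q hp hq =>
    rw [map_add, add_sub_add_comm]
    exact dvd_add hp hq
  | mul_X p i hp =>
    have h1 : ret η e (X i) = X i - C (e i) * lin η := by simp [ret]
    rw [map_mul, h1]
    have h2 : p * X i - ret η e p * (X i - C (e i) * lin η) =
      (p - ret η e p) * X i + ret η e p * C (e i) * lin η := by ring
    rw [h2]
    exact dvd_add (dvd_mul_of_dvd_left hp _) (Dvd.intro_left _ rfl)

lemma ret_lin (l : Fin 4 → k) : ret η e (lin l) = lin (l - (l ⬝ᵥ e) • η) := by
  rw [map_sub, map_smul, lin_apply l, ret, map_sum]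
  simp only [map_smul, aeval_X, smul_sub, Finset.sum_sub_distrib]
  congr 1
  rw [dotProduct, Finset.sum_smul]
  exact Finset.sum_congr rfl fun i _ => by rw [C_mul', smul_smul]

lemma ret_isHomogeneous {p : R4 k} {d : ℕ} (hp : p.IsHomogeneous d) :
    (ret η e p).IsHomogeneous d := by
  have := hp.aeval (fun i => X i - C (e i) * lin η) (n := 1) fun i =>
    (isHomogeneous_X k i).sub ((lin_isHomogeneous η).C_mul (e i))
  rwa [one_mul] at this

lemma eval_ret_of_dotProduct_eq_zero (p : R4 k) {v : Fin 4 → k} (hv : η ⬝ᵥ v = 0) :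
    eval v (ret η e p) = eval v p := by
  rw [eval_ret, hv, zero_smul, sub_zero]

lemma dotProduct_sub_smul (he : η ⬝ᵥ e = 1) (v : Fin 4 → k) : η ⬝ᵥ (v - (η ⬝ᵥ v) • e) = 0 := by
  rw [dotProduct_sub, dotProduct_smul, he, smul_eq_mul, mul_one, sub_self]

/-- A polynomial vanishing on a hyperplane is divisible by its equation. -/
lemma lin_dvd_of_forall_eval_eq_zero [Infinite k] (hη : η ≠ 0) {p : R4 k}
    (h : ∀ v, η ⬝ᵥ v = 0 → eval v p = 0) : lin η ∣ p := by
  obtain ⟨i, hi⟩ := Function.ne_iff.mp hη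
  have he : η ⬝ᵥ Pi.single i (η i)⁻¹ = 1 := by
    rw [dotProduct_single, mul_inv_cancel₀ hi]
  have h0 : ret η (Pi.single i (η i)⁻¹) p = 0 := by
    refine MvPolynomial.funext fun v => ?_
    rw [eval_ret, map_zero]
    exact h _ (dotProduct_sub_smul he v)
  simpa [h0] using dvd_sub_ret (η := η) (e := Pi.single i (η i)⁻¹) p

lemma lin_ne_zero (hη : η ≠ 0) : lin η ≠ 0 := by
  obtain ⟨i, hi⟩ := Function.ne_iff.mp hη
  intro h0
  have := eval_lin η (Pi.single i 1)
  rw [h0, map_zero, dotProduct_single, mul_one] at this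
  exact hi this.symm

lemma not_isUnit_lin (l : Fin 4 → k) : ¬ IsUnit (lin l) := fun h => by
  have := h.map (eval (0 : Fin 4 → k))
  rw [eval_lin, dotProduct_zero] at this
  exact not_isUnit_zero this

lemma not_lin_dvd (hf : f.IsHomogeneous 3) (hi : Irreducible f) (l : Fin 4 → k) : ¬ lin l ∣ f := by
  intro h
  rcases eq_or_ne l 0 with rfl | hl
  · rw [map_zero, zero_dvd_iff] at h
    exact hi.ne_zero h
  obtain ⟨q, hq⟩ := h
  rcases hi.isUnit_or_isUnit hq with h1 | h1
  · exact not_isUnit_lin l h1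
  · have hd : f ∣ lin l := by
      obtain ⟨u, rfl⟩ := h1
      exact ⟨↑u⁻¹, by rw [hq, mul_assoc, Units.mul_inv, mul_one]⟩
    exact lin_ne_zero hl (eq_zero_of_dvd hf (by norm_num) (lin_isHomogeneous l) hd)

/-- A form vanishing on an irreducible plane section of the surface lies in the ideal of the
section. -/
lemma exists_eq_lin_mul_add [IsAlgClosed k] (hf : f.IsHomogeneous 3) (he : η ⬝ᵥ e = 1)
    (hi : Irreducible (ret η e f)) {d : ℕ} {p : R4 k} (hp : p.IsHomogeneous (d + 1))
    (h : ∀ v, η ⬝ᵥ v = 0 → eval v f = 0 → eval v p = 0) :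
    ∃ q r, q.IsHomogeneous d ∧ r ∈ Fd f (d + 1) ∧ p = lin η * q + r := by
  have h1 : ret η e f ∣ ret η e p := by
    have hprime : (Ideal.span {ret η e f}).IsPrime :=
      (Ideal.span_singleton_prime hi.ne_zero).mpr hi.prime
    rw [← Ideal.mem_span_singleton, ← hprime.isRadical.radical,
      ← MvPolynomial.vanishingIdeal_zeroLocus_eq_radical (K := k), mem_vanishingIdeal_iff]
    intro v hv
    rw [mem_zeroLocus_iff] at hv
    have hv := hv _ (Ideal.mem_span_singleton_self _)
    have hev : ∀ q : R4 k, aeval v q = eval v q := DFunLike.congr_fun (coe_aeval_eq_eval v)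
    rw [hev, eval_ret] at hv ⊢
    exact h _ (dotProduct_sub_smul he v) hv
  obtain ⟨b, hb⟩ := h1
  obtain ⟨c, hc⟩ := dvd_sub_ret (η := η) (e := e) p
  obtain ⟨c', hc'⟩ := dvd_sub_ret (η := η) (e := e) f
  have hpe : p = lin η * (c - c' * b) + f * b := by linear_combination hc + hb - b * hc'
  have hcomp := congrArg (homogeneousComponent (d + 1)) hpe
  rw [homogeneousComponent_of_mem hp, if_pos rfl, map_add,
    homogeneousComponent_mul_of_isHomogeneous (lin_isHomogeneous η), if_pos (by omega),
    Nat.add_sub_cancel] at hcomp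
  refine ⟨_, _, homogeneousComponent_isHomogeneous _ _, mem_fd.mpr
    ⟨homogeneousComponent_isHomogeneous _ _, ?_⟩, hcomp⟩
  rw [homogeneousComponent_mul_of_isHomogeneous hf]
  split_ifs
  exacts [Dvd.intro _ rfl, dvd_zero _]

end Retraction

section Lines

variable {k : Type} [Field k] {f : R4 k}

lemma homogeneousComponent_mul_of_totalDegree_le {σ R : Type*} [CommSemiring R]
    {p q : MvPolynomial σ R} {m n : ℕ} (hp : p.totalDegree ≤ m) (hq : q.totalDegree ≤ n) :
    homogeneousComponent (m + n) (p * q) = homogeneousComponent m p * homogeneousComponent n q := by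
  have hs : p = ∑ i ∈ Finset.range (m + 1), homogeneousComponent i p := by
    conv_lhs => rw [← sum_homogeneousComponent p]
    refine Finset.sum_subset (Finset.range_mono (by omega)) fun i _ hi => ?_
    exact homogeneousComponent_eq_zero _ _ (by simpa using hi)
  conv_lhs => rw [hs]
  rw [Finset.sum_mul, map_sum, Finset.sum_range_succ, Finset.sum_eq_zero, zero_add,
    homogeneousComponent_mul_of_isHomogeneous (homogeneousComponent_isHomogeneous m p),
    if_pos (by omega), Nat.add_sub_cancel_left]
  intro i hi
  rw [Finset.mem_range] at hi
  rw [homogeneousComponent_mul_of_isHomogeneous (homogeneousComponent_isHomogeneous i p),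
    if_pos (by omega), homogeneousComponent_eq_zero _ q (by omega), mul_zero]

lemma exists_lin_dvd_of_not_irreducible {F : R4 k} (hF : F.IsHomogeneous 3) (h0 : F ≠ 0)
    (hr : ¬ Irreducible F) : ∃ l, lin l ∣ F := by
  have hu : ¬ IsUnit F := fun h => by
    have h1 := h.map (eval (0 : Fin 4 → k))
    have h2 : eval (0 : Fin 4 → k) F = 0 := by
      have := eval_smul_of_isHomogeneous hF 0 0
      simpa using this
    rw [h2] at h1
    exact not_isUnit_zero h1
  rw [irreducible_iff] at hr
  push Not at hr
  obtain ⟨p, q, hpq, hp, hq⟩ := hr hu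
  have hp0 : p ≠ 0 := by rintro rfl; simp [hpq] at h0
  have hq0 : q ≠ 0 := by rintro rfl; simp [hpq] at h0
  have key : ∀ r : R4 k, r ≠ 0 → ¬ IsUnit r → r.totalDegree ≠ 0 := by
    intro r hr0 hr hd
    rw [totalDegree_eq_zero_iff_eq_C] at hd
    rw [hd] at hr hr0
    exact hr ((IsUnit.mk0 _ (by simpa using hr0)).map C)
  have hd : p.totalDegree + q.totalDegree = 3 := by
    rw [← totalDegree_mul_of_isDomain hp0 hq0, ← hpq, hF.totalDegree h0]
  have hFpq : F = homogeneousComponent p.totalDegree p * homogeneousComponent q.totalDegree q := by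
    rw [← homogeneousComponent_mul_of_totalDegree_le le_rfl le_rfl, hd, ← hpq,
      homogeneousComponent_of_mem hF, if_pos rfl]
  have h1 := key p hp0 hp
  have h2 := key q hq0 hq
  rcases (by omega : p.totalDegree = 1 ∨ q.totalDegree = 1) with h | h <;> rw [h] at hFpq
  · obtain ⟨l, hl⟩ := exists_eq_lin (homogeneousComponent_isHomogeneous 1 p)
    exact ⟨l, by rw [hFpq, hl]; exact Dvd.intro _ rfl⟩
  · obtain ⟨l, hl⟩ := exists_eq_lin (homogeneousComponent_isHomogeneous 1 q)
    exact ⟨l, by rw [hFpq, hl]; exact Dvd.intro_left _ rfl⟩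

/-- The restriction of a polynomial to the parametrized line `u + s • w`. -/
noncomputable def lineRestrict (u w : Fin 4 → k) : R4 k →ₐ[k] Polynomial k :=
  aeval fun i => Polynomial.C (u i) + Polynomial.X * Polynomial.C (w i)

lemma eval_lineRestrict (u w : Fin 4 → k) (p : R4 k) (s : k) :
    (lineRestrict u w p).eval s = eval (u + s • w) p := by
  induction p using MvPolynomial.induction_on with
  | C c => simp [lineRestrict]
  | add p q hp hq => rw [map_add, Polynomial.eval_add, hp, hq, map_add]
  | mul_X p i hp =>
    rw [map_mul, Polynomial.eval_mul, hp, map_mul]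
    have hX : lineRestrict u w (X i) = Polynomial.C (u i) + Polynomial.X * Polynomial.C (w i) := by
      simp [lineRestrict]
    simp [hX, mul_comm s]

lemma eval_derivative_lineRestrict (u w : Fin 4 → k) (p : R4 k) :
    (lineRestrict u w p).derivative.eval 0 = (fun i => eval u (pderiv i p)) ⬝ᵥ w := by
  induction p using MvPolynomial.induction_on with
  | C c => simp [lineRestrict, dotProduct]
  | add p q hp hq =>
    rw [map_add, Polynomial.derivative_add, Polynomial.eval_add, hp, hq, ← add_dotProduct]
    congr 1
    funext i
    simp
  | mul_X p j hp =>
    have hX : lineRestrict u w (X j) = Polynomial.C (u j) + Polynomial.X * Polynomial.C (w j) := by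
      simp [lineRestrict]
    rw [map_mul, Polynomial.derivative_mul, Polynomial.eval_add, Polynomial.eval_mul, hp,
      Polynomial.eval_mul, eval_lineRestrict, eval_lineRestrict, hX]
    simp only [zero_smul, add_zero, eval_X, dotProduct, Derivation.leibniz, smul_eq_mul, map_add,
      map_mul, Polynomial.derivative_C, Polynomial.derivative_mul,
      Polynomial.derivative_X, one_mul, mul_zero, zero_add, Polynomial.eval_C, add_mul,
      Finset.sum_add_distrib, pderiv_X]
    rw [Finset.sum_eq_single (s := Finset.univ (α := Fin 4)) j
      (f := fun x => eval u p * eval u (Pi.single (M := fun _ => R4 k) x 1 j) * w x)]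
    · simp [Finset.sum_mul]
      rw [add_comm]
      congr 1
      exact Finset.sum_congr rfl fun i _ => by ring
    · intro i _ hi
      simp [Pi.single_eq_of_ne hi.symm]
    · simp

lemma eval_add_smul_eq_zero {u w : Fin 4 → k} {p : R4 k} {T : Set k} (hT : T.Infinite)
    (h : ∀ s ∈ T, eval (u + s • w) p = 0) (s : k) : eval (u + s • w) p = 0 := by
  have h0 : lineRestrict u w p = 0 := by
    refine Polynomial.eq_zero_of_infinite_isRoot _ (hT.mono fun s hs => ?_)
    exact (eval_lineRestrict u w p s).trans (h s hs)
  rw [← eval_lineRestrict, h0, Polynomial.eval_zero]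

lemma dotProduct_gradient_eq_zero [Infinite k] {u w : Fin 4 → k} {p : R4 k}
    (h : ∀ s : k, eval (u + s • w) p = 0) : (fun i => eval u (pderiv i p)) ⬝ᵥ w = 0 := by
  have h0 : lineRestrict u w p = 0 := by
    refine Polynomial.funext fun s => ?_
    rw [eval_lineRestrict, h, Polynomial.eval_zero]
  rw [← eval_derivative_lineRestrict, h0, Polynomial.derivative_zero, Polynomial.eval_zero]

lemma exists_ne_zero_forall_dotProduct {n : ℕ} (hn : n < 4) (c : Fin n → Fin 4 → k) :
    ∃ v ≠ 0, ∀ i, c i ⬝ᵥ v = 0 := by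
  have h : (Matrix.mulVecLin (Matrix.of c)).ker ≠ ⊥ :=
    LinearMap.ker_ne_bot_of_finrank_lt (by simpa using hn)
  obtain ⟨v, hv, hv0⟩ := Submodule.exists_mem_ne_zero_of_ne_bot h
  exact ⟨v, hv0, fun i => congr_fun hv i⟩

/-- A linear form that does not vanish at finitely many given nonzero vectors. -/
lemma exists_forall_dotProduct_ne_zero [Infinite k] {ι : Type} [Fintype ι] {z : ι → Fin 4 → k}
    (hz : ∀ i, z i ≠ 0) : ∃ α : Fin 4 → k, ∀ i, α ⬝ᵥ z i ≠ 0 := by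
  have h : ∏ i, lin (z i) ≠ 0 := Finset.prod_ne_zero_iff.mpr fun i _ => lin_ne_zero (hz i)
  by_contra! hcon
  refine h (MvPolynomial.funext fun α => ?_)
  obtain ⟨i, hi⟩ := hcon α
  rw [map_prod, map_zero]
  exact Finset.prod_eq_zero (Finset.mem_univ i) (by rw [eval_lin, dotProduct_comm, hi])

end Lines

section PlaneSections

variable {k : Type} [Field k] {f : R4 k} {α β u₀ u₁ : Fin 4 → k}

/-- If the cubic contains a line in the plane `α + t β = 0`, then that line is spanned by a point
of the axis `α = β = 0` and a point off the axis. -/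
lemma exists_line_spanned (h₀ : eval u₀ f ≠ 0) (hα₀ : α ⬝ᵥ u₀ = 0)
    (hβ₀ : β ⬝ᵥ u₀ = 0) (hα₁ : α ⬝ᵥ u₁ = 0) (hβ₁ : β ⬝ᵥ u₁ = 0)
    (hK : ∀ v, α ⬝ᵥ v = 0 → β ⬝ᵥ v = 0 → ∃ c s : k, v = c • u₁ + s • u₀)
    (hu : ∀ s : k, u₁ + s • u₀ ≠ 0) {t : k} {l : Fin 4 → k}
    (hl : ∀ v, (α + t • β) ⬝ᵥ v = 0 → l ⬝ᵥ v = 0 → eval v f = 0) :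
    ∃ (s : k) (w : Fin 4 → k), α ⬝ᵥ w = -t ∧ β ⬝ᵥ w = 1 ∧
      ∀ x y : k, eval (x • (u₁ + s • u₀) + y • w) f = 0 := by
  have hlu₀ : l ⬝ᵥ u₀ ≠ 0 := fun h => h₀ (hl _ (by simp [add_dotProduct, hα₀, hβ₀]) h)
  obtain ⟨s, hs⟩ : ∃ s : k, l ⬝ᵥ (u₁ + s • u₀) = 0 :=
    ⟨-(l ⬝ᵥ u₁) / (l ⬝ᵥ u₀), by
      rw [dotProduct_add, dotProduct_smul, smul_eq_mul, div_mul_cancel₀ _ hlu₀, add_neg_cancel]⟩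
  set u := u₁ + s • u₀ with hu'
  have hαu : α ⬝ᵥ u = 0 := by simp [hu', dotProduct_add, hα₀, hα₁]
  have hβu : β ⬝ᵥ u = 0 := by simp [hu', dotProduct_add, hβ₀, hβ₁]
  obtain ⟨w, hw₀, hw⟩ : ∃ w : Fin 4 → k, β ⬝ᵥ w ≠ 0 ∧ (α + t • β) ⬝ᵥ w = 0 ∧ l ⬝ᵥ w = 0 := by
    obtain ⟨i, hi⟩ := Function.ne_iff.mp (hu s)
    obtain ⟨w, hw₀, hw⟩ := exists_ne_zero_forall_dotProduct (n := 3) (by norm_num)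
      ![α + t • β, l, Pi.single i 1]
    have h1 := hw 0
    have h2 := hw 1
    have h3 := hw 2
    simp only [Matrix.cons_val, single_one_dotProduct] at h1 h2 h3
    refine ⟨w, fun hβ => hw₀ ?_, h1, h2⟩
    have hα : α ⬝ᵥ w = 0 := by simpa [add_dotProduct, hβ] using h1
    obtain ⟨c, s', hc⟩ := hK w hα hβ
    have hc' : w = c • u + (s' - c * s) • u₀ := by rw [hc, hu']; module
    have h4 : s' - c * s = 0 := by
      rw [hc', dotProduct_add, dotProduct_smul, dotProduct_smul, hs, smul_zero, zero_add,
        smul_eq_mul] at h2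
      exact (mul_eq_zero.mp h2).resolve_right hlu₀
    rw [h4, zero_smul, add_zero] at hc'
    rw [hc', Pi.smul_apply, smul_eq_mul] at h3
    rw [hc', (mul_eq_zero.mp h3).resolve_right hi, zero_smul]
  have hαw : α ⬝ᵥ w = -t * β ⬝ᵥ w := by
    have := hw.1
    rw [add_dotProduct, smul_dotProduct, smul_eq_mul] at this
    linear_combination this
  refine ⟨s, (β ⬝ᵥ w)⁻¹ • w, ?_, ?_, fun x y => hl _ ?_ ?_⟩
  · rw [dotProduct_smul, smul_eq_mul, hαw]; field_simp
  · rw [dotProduct_smul, smul_eq_mul, inv_mul_cancel₀ hw₀]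
  · rw [dotProduct_add, dotProduct_smul, dotProduct_smul, dotProduct_smul, hw.1, add_dotProduct,
      smul_dotProduct, hαu, hβu]
    simp
  · rw [dotProduct_add, dotProduct_smul, dotProduct_smul, dotProduct_smul, hw.2, hs]
    simp

/-- The cubic cannot contain lines through one and the same smooth point in infinitely many planes
of a pencil. -/
lemma finite_lines_through_point [Infinite k] (hf : f.IsHomogeneous 3) (hi : Irreducible f)
    (hK : ∀ v, α ⬝ᵥ v = 0 → β ⬝ᵥ v = 0 → ∃ c s : k, v = c • u₁ + s • u₀) {s : k}
    (hD : (fun i => eval (u₁ + s • u₀) (pderiv i f)) ≠ 0) {T : Set k}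
    (hT : ∀ t ∈ T, ∃ w, α ⬝ᵥ w = -t ∧ β ⬝ᵥ w = 1 ∧
      ∀ x y : k, eval (x • (u₁ + s • u₀) + y • w) f = 0) : T.Finite := by
  by_contra hinf
  rw [← Set.Infinite] at hinf
  set u := u₁ + s • u₀ with hu
  set D := (fun i => eval u (pderiv i f)) with hDdef
  obtain ⟨t₁, ht₁⟩ := hinf.nonempty
  obtain ⟨t₂, ht₂, hne⟩ := hinf.exists_notMem_finite (Set.finite_singleton t₁)
  have ht : t₂ - t₁ ≠ 0 := sub_ne_zero.mpr hne
  choose! w hα hβ hw using hT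
  have hDw : ∀ t ∈ T, D ⬝ᵥ w t = 0 := fun t ht => dotProduct_gradient_eq_zero fun y => by
    simpa using hw t ht 1 y
  have hDu : D ⬝ᵥ u = 0 := dotProduct_gradient_eq_zero fun y => by
    simpa [add_smul] using hw t₁ ht₁ (1 + y) 0
  have hKu : ∀ v, α ⬝ᵥ v = 0 → β ⬝ᵥ v = 0 → ∃ c s : k, v = c • u + s • u₀ := fun v h1 h2 => by
    obtain ⟨c, s', hc⟩ := hK v h1 h2
    exact ⟨c, s' - c * s, by rw [hc, hu]; module⟩
  have hDu₀ : D ⬝ᵥ u₀ ≠ 0 := by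
    intro h0
    refine hD (dotProduct_eq_zero _ fun x => ?_)
    obtain ⟨c, s', hc⟩ := hKu (x - ((t₂ * β ⬝ᵥ x + α ⬝ᵥ x) / (t₂ - t₁)) • w t₁
        + ((t₁ * β ⬝ᵥ x + α ⬝ᵥ x) / (t₂ - t₁)) • w t₂) (by
      simp only [dotProduct_add, dotProduct_sub, dotProduct_smul, hα _ ht₁, hα _ ht₂, smul_eq_mul]
      field_simp
      ring) (by
      simp only [dotProduct_add, dotProduct_sub, dotProduct_smul, hβ _ ht₁, hβ _ ht₂, smul_eq_mul]
      field_simp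
      ring)
    have := congr_arg (D ⬝ᵥ ·) hc
    simpa [dotProduct_add, dotProduct_sub, dotProduct_smul, hDw _ ht₁, hDw _ ht₂, hDu, h0]
      using this
  have hKD : ∀ v, α ⬝ᵥ v = 0 → β ⬝ᵥ v = 0 → D ⬝ᵥ v = 0 → ∃ c : k, v = c • u :=
    fun v h1 h2 h3 => by
      obtain ⟨c, s', hc⟩ := hKu v h1 h2
      rw [hc, dotProduct_add, dotProduct_smul, dotProduct_smul, hDu, smul_zero, zero_add,
        smul_eq_mul] at h3
      exact ⟨c, by rw [hc, (mul_eq_zero.mp h3).resolve_right hDu₀, zero_smul, add_zero]⟩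
  have hmain : ∀ x, D ⬝ᵥ x = 0 → β ⬝ᵥ x ≠ 0 → eval x f = 0 := by
    intro x hx hb
    have := eval_add_smul_eq_zero (p := f) (u := x) (w := w t₁ - w t₂)
      (T := (fun t => (-t * β ⬝ᵥ x - α ⬝ᵥ x) / (t₂ - t₁)) '' T) (hinf.image ?_) ?_ 0
    · simpa using this
    · intro t _ t' _ h
      simp only [div_left_inj' ht, sub_left_inj, mul_eq_mul_right_iff, neg_inj, hb, or_false] at h
      exact h
    · rintro _ ⟨t, htT, rfl⟩
      obtain ⟨c, hc⟩ := hKD (x + ((-t * β ⬝ᵥ x - α ⬝ᵥ x) / (t₂ - t₁)) • (w t₁ - w t₂)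
          - (β ⬝ᵥ x) • w t) (by
        simp only [dotProduct_add, dotProduct_sub, dotProduct_smul, hα _ ht₁, hα _ ht₂, hα _ htT,
          smul_eq_mul]
        field_simp
        ring) (by
        simp only [dotProduct_add, dotProduct_sub, dotProduct_smul, hβ _ ht₁, hβ _ ht₂, hβ _ htT,
          smul_eq_mul]
        field_simp
        ring) (by
        simp only [dotProduct_add, dotProduct_sub, dotProduct_smul, hDw _ ht₁, hDw _ ht₂,
          hDw _ htT, hx, smul_eq_mul]
        ring)
      rw [sub_eq_iff_eq_add.mp hc]
      exact hw t htT _ _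
  refine not_lin_dvd hf hi D (lin_dvd_of_forall_eval_eq_zero hD fun x hx => ?_)
  by_cases hb : β ⬝ᵥ x = 0
  · have := eval_add_smul_eq_zero (p := f) (u := x) (w := w t₁) (T := {0}ᶜ)
      (Set.finite_singleton 0).infinite_compl (fun y hy => hmain _ ?_ ?_) 0
    · simpa using this
    · rw [dotProduct_add, dotProduct_smul, hx, hDw _ ht₁, smul_zero, add_zero]
    · rw [dotProduct_add, dotProduct_smul, hb, hβ _ ht₁, zero_add, smul_eq_mul, mul_one]
      exact hy
  · exact hmain x hx hb

end PlaneSections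

section PlaneExistence

variable {k : Type} [Field k] {f : R4 k}

lemma exists_axis_basis {α β e b u₀ : Fin 4 → k} (hαe : α ⬝ᵥ e = 1) (hβe : β ⬝ᵥ e = 0)
    (hαb : α ⬝ᵥ b = 0) (hβb : β ⬝ᵥ b = 1) (hα₀ : α ⬝ᵥ u₀ = 0) (hβ₀ : β ⬝ᵥ u₀ = 0)
    (hu₀ : u₀ ≠ 0) :
    ∃ u₁ : Fin 4 → k, α ⬝ᵥ u₁ = 0 ∧ β ⬝ᵥ u₁ = 0 ∧ (∀ s : k, u₁ + s • u₀ ≠ 0) ∧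
      ∀ v, α ⬝ᵥ v = 0 → β ⬝ᵥ v = 0 → ∃ c s : k, v = c • u₁ + s • u₀ := by
  let L : (Fin 4 → k) →ₗ[k] Fin 2 → k := Matrix.mulVecLin (Matrix.of ![α, β])
  have hL : ∀ v, L v = ![α ⬝ᵥ v, β ⬝ᵥ v] := fun v => by
    funext i
    fin_cases i <;> rfl
  have hker : ∀ v, v ∈ L.ker ↔ α ⬝ᵥ v = 0 ∧ β ⬝ᵥ v = 0 := fun v => by
    rw [LinearMap.mem_ker, hL]
    constructor
    · intro h
      exact ⟨congr_fun h 0, congr_fun h 1⟩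
    · rintro ⟨h1, h2⟩
      rw [h1, h2]
      simp
  have hsurj : L.range = ⊤ := by
    refine LinearMap.range_eq_top.mpr fun y => ⟨y 0 • e + y 1 • b, ?_⟩
    rw [hL]
    funext i
    fin_cases i <;> simp [dotProduct_add, hαe, hβe, hαb, hβb]
  have hrank : Module.finrank k L.ker = Module.finrank k (k ∙ u₀) + 1 := by
    have := L.finrank_range_add_finrank_ker
    rw [hsurj, finrank_top, Module.finrank_fin_fun, Module.finrank_fin_fun] at this
    rw [finrank_span_singleton hu₀]
    omega
  obtain ⟨g, hg, hgi, hgs⟩ := exists_basis_mod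
    ((Submodule.span_singleton_le_iff_mem _ _).mpr ((hker u₀).mpr ⟨hα₀, hβ₀⟩)) hrank
  refine ⟨g 0, ((hker _).mp (hg 0)).1, ((hker _).mp (hg 0)).2, fun s hs => ?_, fun v h1 h2 => ?_⟩
  · have := hgi (fun _ => 1) (by
      rw [Fin.sum_univ_one, one_smul, eq_neg_of_add_eq_zero_left hs]
      exact neg_mem (Submodule.smul_mem _ _ (Submodule.mem_span_singleton_self _)))
    exact one_ne_zero (congr_fun this 0)
  · obtain ⟨c, hc⟩ := hgs v ((hker v).mpr ⟨h1, h2⟩)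
    obtain ⟨s, hs⟩ := Submodule.mem_span_singleton.mp hc
    refine ⟨c 0, s, ?_⟩
    rw [hs, Fin.sum_univ_one, add_sub_cancel]

lemma exists_dotProduct_eq_one {α : Fin 4 → k} (hα : α ≠ 0) : ∃ e : Fin 4 → k, α ⬝ᵥ e = 1 := by
  obtain ⟨i, hi⟩ := Function.ne_iff.mp hα
  exact ⟨Pi.single i (α i)⁻¹, by rw [dotProduct_single, mul_inv_cancel₀ hi]⟩

/-- A smooth cubic surface has an irreducible plane section that avoids finitely many given
points. -/
lemma exists_irreducible_plane_section [Infinite k] (hf : f.IsHomogeneous 3) (hi : Irreducible f)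
    (hs : ∀ v : Fin 4 → k, v ≠ 0 → eval v f = 0 → ∃ i, eval v (pderiv i f) ≠ 0)
    {ι : Type} [Fintype ι] [Nonempty ι] {z : ι → Fin 4 → k} (hz : ∀ i, z i ≠ 0) :
    ∃ η e : Fin 4 → k, η ⬝ᵥ e = 1 ∧ (∀ i, η ⬝ᵥ z i ≠ 0) ∧ Irreducible (ret η e f) := by
  obtain ⟨α, hα⟩ := exists_forall_dotProduct_ne_zero hz
  have hα0 : α ≠ 0 := by
    rintro rfl
    exact hα (Classical.arbitrary ι) (zero_dotProduct _)
  obtain ⟨u₀, hα₀, h₀⟩ : ∃ u₀, α ⬝ᵥ u₀ = 0 ∧ eval u₀ f ≠ 0 := by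
    by_contra! h
    exact not_lin_dvd hf hi α (lin_dvd_of_forall_eval_eq_zero hα0 h)
  obtain ⟨e, hαe⟩ := exists_dotProduct_eq_one hα0
  obtain ⟨β, hβ0, hβ⟩ := exists_ne_zero_forall_dotProduct (n := 2) (by norm_num) ![u₀, e]
  have hβ₀ : β ⬝ᵥ u₀ = 0 := by rw [dotProduct_comm]; exact hβ 0
  have hβe : β ⬝ᵥ e = 0 := by rw [dotProduct_comm]; exact hβ 1
  obtain ⟨b, hb⟩ := exists_dotProduct_eq_one hβ0
  have hu₀ : u₀ ≠ 0 := by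
    rintro rfl
    refine h₀ ?_
    simpa using eval_smul_of_isHomogeneous hf 0 0
  obtain ⟨u₁, hα₁, hβ₁, hu, hK⟩ := exists_axis_basis (b := b - (α ⬝ᵥ b) • e) hαe hβe
    (by rw [dotProduct_sub, dotProduct_smul, hαe, smul_eq_mul, mul_one, sub_self])
    (by rw [dotProduct_sub, dotProduct_smul, hβe, smul_zero, sub_zero, hb]) hα₀ hβ₀ hu₀
  have hη : ∀ t : k, (α + t • β) ⬝ᵥ e = 1 := fun t => by
    rw [add_dotProduct, smul_dotProduct, hβe, smul_zero, add_zero, hαe]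
  -- only finitely many members of the pencil meet a given point
  have hfin₁ : (⋃ i, {t : k | (α + t • β) ⬝ᵥ z i = 0}).Finite := by
    refine Set.finite_iUnion fun i => Set.Subsingleton.finite fun t ht t' ht' => ?_
    have h1 : α ⬝ᵥ z i + t * β ⬝ᵥ z i = 0 := by
      simpa [add_dotProduct, smul_dotProduct] using (show (α + t • β) ⬝ᵥ z i = 0 from ht)
    have h2 : α ⬝ᵥ z i + t' * β ⬝ᵥ z i = 0 := by
      simpa [add_dotProduct, smul_dotProduct] using (show (α + t' • β) ⬝ᵥ z i = 0 from ht')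
    have h3 : (t - t') * β ⬝ᵥ z i = 0 := by linear_combination h1 - h2
    rcases mul_eq_zero.mp h3 with h | h
    · exact sub_eq_zero.mp h
    · rw [h, mul_zero, add_zero] at h1
      exact absurd h1 (hα i)
  -- only finitely many members of the pencil have a reducible section
  set Q : k → Set k := fun s => {t | ∃ w, α ⬝ᵥ w = -t ∧ β ⬝ᵥ w = 1 ∧
    ∀ x y : k, eval (x • (u₁ + s • u₀) + y • w) f = 0} with hQ
  have hpoly : lineRestrict u₁ u₀ f ≠ 0 := by
    intro h0
    have h1 : ∀ s : k, eval (u₁ + s • u₀) f = 0 := fun s => by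
      rw [← eval_lineRestrict, h0, Polynomial.eval_zero]
    refine h₀ ?_
    have := eval_add_smul_eq_zero (p := f) (u := u₀) (w := u₁) (T := {0}ᶜ)
      (Set.finite_singleton 0).infinite_compl (fun c hc => ?_) 0
    · simpa using this
    · have h2 : u₀ + c • u₁ = c • (u₁ + c⁻¹ • u₀) := by
        rw [smul_add, smul_smul, mul_inv_cancel₀ hc, one_smul, add_comm]
      rw [h2, eval_smul_of_isHomogeneous hf, h1, mul_zero]
  have hfin₂ : (⋃ s ∈ {s : k | (lineRestrict u₁ u₀ f).IsRoot s}, Q s).Finite := by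
    refine (Polynomial.finite_setOfPred_isRoot hpoly).biUnion fun s hs' => ?_
    refine finite_lines_through_point hf hi hK (s := s) (fun h => ?_) fun t ht => ht
    obtain ⟨i, hi'⟩ := hs _ (hu s) ((eval_lineRestrict u₁ u₀ f s).symm.trans hs')
    exact hi' (congr_fun h i)
  obtain ⟨t, ht⟩ := (hfin₁.union hfin₂).exists_notMem
  rw [Set.mem_union, not_or] at ht
  refine ⟨α + t • β, e, hη t, fun i h => ht.1 (Set.mem_iUnion.mpr ⟨i, h⟩), ?_⟩
  by_contra hirr
  obtain ⟨l, hl⟩ := exists_lin_dvd_of_not_irreducible (ret_isHomogeneous hf)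
    (fun h0 => h₀ (by
      rw [← eval_ret_of_dotProduct_eq_zero (η := α + t • β) (e := e) f
        (by rw [add_dotProduct, smul_dotProduct, hα₀, hβ₀, smul_zero, add_zero]), h0, map_zero]))
    hirr
  obtain ⟨s, w, hw⟩ := exists_line_spanned h₀ hα₀ hβ₀ hα₁ hβ₁ hK hu (t := t) (l := l)
    fun v hv hlv => by
      obtain ⟨q, hq⟩ := hl
      rw [← eval_ret_of_dotProduct_eq_zero f hv, hq, map_mul, eval_lin, hlv, zero_mul]
  refine ht.2 (Set.mem_biUnion (x := s) ?_ ⟨w, hw⟩)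
  refine (eval_lineRestrict u₁ u₀ f s).trans ?_
  simpa using hw.2.2 1 0

end PlaneExistence

section Separation

variable {k : Type} [Field k]

lemma finrank_inf_ker {M : Type*} [AddCommGroup M] [Module k M] {U : Submodule k M}
    [FiniteDimensional k U] {n : ℕ} {φ : M →ₗ[k] (Fin n → k)} (h : U.map φ = ⊤) :
    Module.finrank k (U ⊓ LinearMap.ker φ : Submodule k M) + n = Module.finrank k U := by
  have h1 := (φ.domRestrict U).finrank_range_add_finrank_ker
  have h2 : (φ.domRestrict U).ker.map U.subtype = U ⊓ φ.ker := by
    rw [LinearMap.ker_domRestrict, Submodule.map_comap_subtype]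
  rw [LinearMap.range_domRestrict, h, finrank_top, Module.finrank_fin_fun] at h1
  rw [← h2, ← (Submodule.equivMapOfInjective _ U.injective_subtype _).finrank_eq]
  omega

/-- A space of polynomials can be separated by as many points of `E` as its dimension modulo the
polynomials vanishing on `E`. -/
lemma exists_separating_points {U N : Submodule k (R4 k)} [FiniteDimensional k U]
    [FiniteDimensional k N] {E : Set (Fin 4 → k)}
    (hN : ∀ p ∈ U, (∀ v ∈ E, eval v p = 0) → p ∈ N) {n : ℕ}
    (hn : Module.finrank k N + n ≤ Module.finrank k U) :
    ∃ w : Fin n → Fin 4 → k, (∀ i, w i ∈ E) ∧ U.map (evs w) = ⊤ := by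
  induction n with
  | zero => exact ⟨Fin.elim0, fun i => i.elim0, Subsingleton.elim _ _⟩
  | succ n ih =>
    obtain ⟨w, hw, hsurj⟩ := ih (by omega)
    obtain ⟨p, hp, hpN⟩ : ∃ p ∈ U ⊓ LinearMap.ker (evs w), p ∉ N := by
      by_contra! hcon
      have h1 := Submodule.finrank_mono hcon
      have h2 := finrank_inf_ker hsurj
      omega
    obtain ⟨v, hv, hpv⟩ : ∃ v ∈ E, eval v p ≠ 0 := by
      by_contra! hcon
      exact hpN (hN p hp.1 hcon)
    have hp0 : ∀ i, eval (w i) p = 0 := fun i => by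
      rw [← evs_apply, LinearMap.mem_ker.mp hp.2, Pi.zero_apply]
    refine ⟨Fin.cons v w, Fin.cases hv hw, eq_top_iff.mpr fun c _ => ?_⟩
    obtain ⟨q, hq, hqc⟩ : Fin.tail c ∈ U.map (evs w) := hsurj ▸ Submodule.mem_top
    refine ⟨q + ((c 0 - eval v q) / eval v p) • p, U.add_mem hq (U.smul_mem _ hp.1), ?_⟩
    funext i
    rw [evs_apply]
    refine Fin.cases ?_ (fun i => ?_) i
    · rw [Fin.cons_zero, map_add, smul_eval, div_mul_cancel₀ _ hpv, add_sub_cancel]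
    · rw [Fin.cons_succ, map_add, smul_eval, hp0, mul_zero, add_zero, ← evs_apply, hqc]
      rfl

lemma eval_zero_of_isHomogeneous {p : R4 k} {d : ℕ} (hp : p.IsHomogeneous (d + 1)) :
    eval (0 : Fin 4 → k) p = 0 := by
  simpa using eval_smul_of_isHomogeneous hp 0 0

lemma ne_zero_of_map_evs_eq_top {U : Submodule k (R4 k)} {d n : ℕ}
    (hU : U ≤ homogeneousSubmodule (Fin 4) k (d + 1)) {w : Fin n → Fin 4 → k}
    (hw : U.map (evs w) = ⊤) (i : Fin n) : w i ≠ 0 := by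
  intro h0
  obtain ⟨q, hq, hqc⟩ : (fun _ => 1 : Fin n → k) ∈ U.map (evs w) := hw ▸ Submodule.mem_top
  have := congr_fun hqc i
  rw [evs_apply, h0, eval_zero_of_isHomogeneous (hU hq)] at this
  exact zero_ne_one this

lemma eq_zero_of_sum_mul_eval {U : Submodule k (R4 k)} {n : ℕ} {w : Fin n → Fin 4 → k}
    (hw : U.map (evs w) = ⊤) {c : Fin n → k}
    (hc : ∀ q ∈ U, ∑ i, c i * eval (w i) q = 0) : c = 0 := by
  classical
  funext i
  obtain ⟨q, hq, hqc⟩ : (Pi.single i 1 : Fin n → k) ∈ U.map (evs w) := hw ▸ Submodule.mem_top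
  have h1 := hc q hq
  simp_rw [← evs_apply, hqc] at h1
  simpa [Pi.single_apply] using h1

end Separation

section Existence

variable {k : Type} [Field k] {f : R4 k} {a : ℕ} {ι : Type} [Fintype ι] {z : ι → Fin 4 → k}

lemma linMul_smul_mem_range_id {n : ℕ} (g : Fin n → R4 k) (η : Fin 4 → k) :
    (linMul f a g (LinearMap.toSpanSingleton k _ η)).range ≤
      (linMul f a g LinearMap.id).range := by
  rintro _ ⟨x, rfl⟩
  exact ⟨(fun j => x.1 j • η, x.2), by rw [linMul_apply, linMul_apply]; rfl⟩

lemma linMul_toSpanSingleton {n : ℕ} (g : Fin n → R4 k) (η : Fin 4 → k)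
    (x : (Fin n → k) × Fd f (a + 1)) :
    linMul f a g (LinearMap.toSpanSingleton k _ η) x =
      lin η * ∑ j, x.1 j • g j + x.2 := by
  rw [linMul_apply, Finset.mul_sum]
  simp

lemma Good.mem_range_of_forall_eval_eq_zero [IsAlgClosed k] (h : Good f a z)
    (hf : f.IsHomogeneous 3) {n : ℕ} {g : Fin n → R4 k}
    (hgs : ∀ v ∈ Iz z a, ∃ c : Fin n → k, v - ∑ j, c j • g j ∈ Fd f a)
    {η e : Fin 4 → k} (he : η ⬝ᵥ e = 1) (hz : ∀ i, η ⬝ᵥ z i ≠ 0)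
    (hi : Irreducible (ret η e f)) {p : R4 k} (hp : p ∈ Iz z (a + 1))
    (h0 : ∀ v ∈ {v : Fin 4 → k | η ⬝ᵥ v = 0 ∧ eval v f = 0}, eval v p = 0) :
    p ∈ (linMul f a g (LinearMap.toSpanSingleton k _ η)).range := by
  obtain ⟨q, r, hq, hr, rfl⟩ := exists_eq_lin_mul_add hf he hi hp.1 fun v h1 h2 => h0 v ⟨h1, h2⟩
  have hqz : q ∈ Iz z a := ⟨hq, fun i => by
    have h1 := hp.2 i
    rw [map_add, map_mul, eval_lin, (h.fd_le _ hr).2 i, add_zero] at h1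
    exact (mul_eq_zero.mp h1).resolve_left (hz i)⟩
  obtain ⟨c, hc⟩ := hgs q hqz
  have hr' : lin η * (q - ∑ j, c j • g j) + r ∈ Fd f (a + 1) := by
    refine Submodule.add_mem _ ?_ hr
    rw [mem_fd] at hc ⊢
    refine ⟨?_, hc.2.mul_left _⟩
    rw [add_comm]
    exact (lin_isHomogeneous η).mul hc.1
  refine ⟨(c, ⟨_, hr'⟩), ?_⟩
  rw [linMul_toSpanSingleton]
  ring

/-- The lifting property survives the addition of points on a plane section, provided that these
points impose the expected conditions. -/
lemma Good.lift_succ (h : Good f a z) (hf : f.IsHomogeneous 3) (hprime : Prime f) {n : ℕ} {g : Fin n → R4 k}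
    (hg : ∀ j, g j ∈ Iz z a)
    {η e : Fin 4 → k} (he : η ⬝ᵥ e = 1) (hi : Irreducible (ret η e f)) {s : R4 k}
    (hs : s.IsHomogeneous (a + 1)) (hsf : ∃ v, η ⬝ᵥ v = 0 ∧ eval v f = 0 ∧ eval v s ≠ 0)
    (hsN : ∀ κ : k, κ • s ∈ (linMul f a g LinearMap.id).range → κ = 0) {q : Fin 4 → R4 k}
    (hq : ∀ i, ∃ c : k, q i - c • s ∈ (linMul f a g (LinearMap.toSpanSingleton k _ η)).range)
    (hdvd : f ∣ ∑ i, X i * q i) (i : Fin 4) : f ∣ q i := by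
  choose c x hx using hq
  simp_rw [linMul_toSpanSingleton] at hx
  set q' : Fin 4 → R4 k := fun i => ∑ j, (x i).1 j • g j with hq'
  have hqz : ∀ i, q' i ∈ Iz z a := fun i =>
    Submodule.sum_mem _ fun j _ => Submodule.smul_mem _ _ (hg j)
  have hqi : ∀ i, q i = c i • s + lin η * q' i + (x i).2 := fun i => by
    rw [add_assoc, hx, add_sub_cancel]
  have hr : ∀ i, f ∣ ((x i).2 : R4 k) := fun i => (mem_fd.mp (x i).2.2).2
  have hdvd₁ : f ∣ lin c * s + lin η * ∑ i, X i * q' i := by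
    have h1 : lin c * s + lin η * ∑ i, X i * q' i =
        ∑ i, X i * q i - ∑ i, X i * ((x i).2 : R4 k) := by
      rw [← Finset.sum_sub_distrib, lin_apply, Finset.sum_mul, Finset.mul_sum,
        ← Finset.sum_add_distrib]
      refine Finset.sum_congr rfl fun i _ => ?_
      rw [hqi, smul_mul_assoc, ← mul_smul_comm]
      ring
    rw [h1]
    exact dvd_sub hdvd (Finset.dvd_sum fun i _ => (hr i).mul_left _)
  have hη : ret η e (lin η) = 0 := by
    rw [ret_lin, he, one_smul, sub_self, map_zero]
  have hret : ret η e f ∣ ret η e (lin c) * ret η e s := by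
    have := map_dvd (ret η e) hdvd₁
    rwa [map_add, map_mul, map_mul, hη, zero_mul, add_zero] at this
  have hretc : ret η e (lin c) = 0 := by
    rcases hi.prime.dvd_or_dvd hret with h1 | h1
    · exact eq_zero_of_dvd (ret_isHomogeneous hf) (by norm_num)
        (ret_isHomogeneous (lin_isHomogeneous c)) h1
    · obtain ⟨v, hv, hvf, hvs⟩ := hsf
      refine absurd ?_ hvs
      obtain ⟨y, hy⟩ := h1
      rw [← eval_ret_of_dotProduct_eq_zero s hv, hy, map_mul,
        eval_ret_of_dotProduct_eq_zero f hv, hvf, zero_mul]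
  have hc : c = (c ⬝ᵥ e) • η := by
    rw [ret_lin] at hretc
    by_contra hne
    exact lin_ne_zero (sub_ne_zero.mpr hne) hretc
  set κ := c ⬝ᵥ e
  have hη0 : η ≠ 0 := by
    rintro rfl
    simp at he
  have hdvd₂ : f ∣ κ • s + ∑ i, X i * q' i := by
    have h1 : f ∣ lin η * (κ • s + ∑ i, X i * q' i) := by
      convert! hdvd₁ using 1
      rw [hc, map_smul, mul_add, smul_mul_assoc, mul_smul_comm]
    refine (hprime.dvd_or_dvd h1).resolve_left fun h2 => lin_ne_zero hη0 ?_
    exact eq_zero_of_dvd hf (by norm_num) (lin_isHomogeneous η) h2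
  have hκ : κ = 0 := by
    refine hsN κ ⟨(fun j i => -(x i).1 j, ⟨κ • s + ∑ i, X i * q' i, mem_fd.mpr ⟨?_, hdvd₂⟩⟩), ?_⟩
    · refine Submodule.add_mem (homogeneousSubmodule (Fin 4) k (a + 1))
        (Submodule.smul_mem _ _ hs) (Submodule.sum_mem _ fun i _ => ?_)
      rw [mem_homogeneousSubmodule, add_comm]
      exact (isHomogeneous_X k i).mul (hqz i).1
    · have h1 : ∑ i, X i * q' i = ∑ j, lin (fun i => (x i).1 j) * g j := by
        simp_rw [lin_apply, hq', Finset.sum_mul, Finset.mul_sum]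
        rw [Finset.sum_comm]
        simp_rw [mul_smul_comm, smul_mul_assoc]
      have h2 : ∀ j, lin (fun i => -(x i).1 j) = -lin (fun i => (x i).1 j) := fun j =>
        map_neg lin (fun i => (x i).1 j)
      rw [linMul_apply]
      simp only [LinearMap.id_apply, h2, neg_mul, Finset.sum_neg_distrib, h1]
      ring
  rw [hκ, zero_smul, zero_add] at hdvd₂
  have hq'i := h.lift q' hqz hdvd₂ i
  have hci : c i = 0 := by rw [hc, hκ, zero_smul, Pi.zero_apply]
  rw [hqi, hci, zero_smul, zero_add]
  exact dvd_add (hq'i.mul_left _) (hr i)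

lemma Good.exists_succ [IsAlgClosed k] (h : Good f a z) (hf : f.IsHomogeneous 3)
    (hprime : Prime f) (hcard : 2 * Fintype.card ι = 3 * a * a + a + 2) {η e : Fin 4 → k}
    (he : η ⬝ᵥ e = 1) (hz : ∀ i, η ⬝ᵥ z i ≠ 0) (hi : Irreducible (ret η e f)) :
    ∃ w : Fin (3 * a) ⊕ Fin 2 → Fin 4 → k, Good f (a + 1) (Sum.elim z w) := by
  obtain ⟨g, hg, hgi, hgs⟩ := h.exists_basis hf hprime.ne_zero hcard
  have hη0 : η ≠ 0 := by
    rintro rfl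
    simp at he
  set V := Iz z (a + 1)
  set V' := (linMul f a g LinearMap.id).range with hV'
  set N := (linMul f a g (LinearMap.toSpanSingleton k _ η)).range with hN
  set E := {v : Fin 4 → k | η ⬝ᵥ v = 0 ∧ eval v f = 0}
  have hV'V : V' ≤ V := h.range_linMul_le hg
  have hNV' : N ≤ V' := linMul_smul_mem_range_id g η
  have hVN : ∀ p ∈ V, (∀ v ∈ E, eval v p = 0) → p ∈ N := fun p hp =>
    h.mem_range_of_forall_eval_eq_zero hf hgs he hz hi hp
  have hNE : ∀ p ∈ N, ∀ v ∈ E, eval v p = 0 := by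
    rintro _ ⟨x, rfl⟩ v ⟨hv, hvf⟩
    obtain ⟨y, hy⟩ := (mem_fd.mp x.2.2).2
    rw [linMul_toSpanSingleton, map_add, map_mul, eval_lin, hv, zero_mul, zero_add, hy, map_mul,
      hvf, zero_mul]
  have hrV' : Module.finrank k V' = a * 4 + Module.finrank k (Fd f (a + 1)) := by
    rw [hV', h.finrank_range_linMul hg hgi Function.injective_id, Module.finrank_fin_fun]
  have hrN : Module.finrank k N = a * 1 + Module.finrank k (Fd f (a + 1)) := by
    rw [hN, h.finrank_range_linMul hg hgi
      (LinearMap.ker_eq_bot.mp (LinearMap.ker_toSpanSingleton k hη0)), Module.finrank_self]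
  have hrV : Module.finrank k V = Module.finrank k N + (3 * a + 3) := by
    have := h.finrank_iz hf hprime.ne_zero hcard (Nat.le_succ a)
    change 2 * Module.finrank k V + _ + _ = _ at this
    rw [Nat.succ_eq_add_one] at this
    nlinarith
  have hfV' : FiniteDimensional k V' := Submodule.finiteDimensional_of_le hV'V
  have hfN : FiniteDimensional k N := Submodule.finiteDimensional_of_le (hNV'.trans hV'V)
  obtain ⟨w₀, hw₀, hs₀⟩ := exists_separating_points (n := 3 * a)
    (fun p hp => hVN p (hV'V hp)) (by omega)
  have hs₀' : V.map (evs w₀) = ⊤ := top_le_iff.mp (hs₀ ▸ Submodule.map_mono hV'V)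
  have hVN₀ : N = V' ⊓ LinearMap.ker (evs w₀) := by
    refine Submodule.eq_of_le_of_finrank_eq (le_inf hNV' fun p hp => ?_) ?_
    · exact LinearMap.mem_ker.mpr (_root_.funext fun i => by
        rw [evs_apply]; exact hNE p hp _ (hw₀ i))
    · have := finrank_inf_ker hs₀
      omega
  have hr₀ := finrank_inf_ker hs₀'
  set U := V ⊓ LinearMap.ker (evs w₀)
  obtain ⟨w₁, hw₁, hs₁⟩ := exists_separating_points (U := U) (n := 2)
    (fun p hp => hVN p hp.1) (by omega)
  have hr₁ := finrank_inf_ker hs₁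
  set T := U ⊓ LinearMap.ker (evs w₁) with hT
  have hNT : N ≤ T := by
    refine le_inf (le_inf (hNV'.trans hV'V) fun p hp => ?_) fun p hp => ?_ <;>
    · refine LinearMap.mem_ker.mpr (_root_.funext fun i => ?_)
      rw [evs_apply]
      exact hNE p hp _ (by first | exact hw₀ i | exact hw₁ i)
  obtain ⟨s, hsT, hsi, hss⟩ := exists_basis_mod hNT (n := 1) (by omega)
  simp only [Fin.sum_univ_one] at hsi hss
  have hTiz : Iz (Sum.elim z (Sum.elim w₀ w₁)) (a + 1) = T := by
    ext p
    simp only [hT, U, V, Submodule.mem_inf, mem_iz, LinearMap.mem_ker, funext_iff, evs_apply,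
      Sum.forall, Sum.elim_inl, Sum.elim_inr, Pi.zero_apply, and_assoc]
  have hVh : V ≤ homogeneousSubmodule (Fin 4) k (a + 1) := fun p hp => hp.1
  refine ⟨Sum.elim w₀ w₁, ?_, ?_, ?_, ?_⟩
  · rintro (i | i | i)
    · exact h.ne_zero i
    · exact ne_zero_of_map_evs_eq_top hVh hs₀' i
    · exact ne_zero_of_map_evs_eq_top (inf_le_left.trans hVh) hs₁ i
  · rintro (i | i | i)
    · exact h.vanish i
    · exact (hw₀ i).2
    · exact (hw₁ i).2
  · intro c hc
    simp only [Fintype.sum_sum_type, Sum.elim_inl, Sum.elim_inr] at hc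
    have h1 : (fun i => c (.inr (.inr i))) = 0 := eq_zero_of_sum_mul_eval hs₁ fun q hq => by
      have := hc q hq.1.1
      have h2 : ∀ i, eval (w₀ i) q = 0 := fun i => by
        rw [← evs_apply, LinearMap.mem_ker.mp hq.2, Pi.zero_apply]
      simpa [hq.1.2, h2] using this
    have h2 : (fun i => c (.inr (.inl i))) = 0 := eq_zero_of_sum_mul_eval hs₀' fun q hq => by
      have := hc q hq.1
      have h3 := congr_fun h1
      simp only [Pi.zero_apply] at h3
      simpa [hq.2, h3] using this
    have h3 : (fun i => c (.inl i) * η ⬝ᵥ z i) = 0 := h.indep _ fun q hq => by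
      have := hc (q * lin η) (hq.mul (lin_isHomogeneous η))
      have h4 := congr_fun h1
      have h5 := congr_fun h2
      simp only [Pi.zero_apply] at h4 h5
      simp only [h4, h5, zero_mul, Finset.sum_const_zero, add_zero, map_mul, eval_lin] at this
      rw [← this]
      exact Finset.sum_congr rfl fun i _ => by ring
    funext i
    rcases i with i | i | i
    · exact (mul_eq_zero.mp (congr_fun h3 i)).resolve_right (hz i)
    · exact congr_fun h2 i
    · exact congr_fun h1 i
  · intro q hq hdvd
    rw [hTiz] at hq
    refine h.lift_succ hf hprime hg he hi (s := s 0) (hsT 0).1.1.1 ?_ (fun κ hκ => ?_)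
      (fun i => ?_) hdvd
    · by_contra! hcon
      have h1 := hsi 1 (N.smul_mem _ (hVN _ (hsT 0).1.1 fun v hv => hcon v hv.1 hv.2))
      exact one_ne_zero (congr_fun h1 0)
    · have h1 : κ • s 0 ∈ N := by
        rw [hVN₀]
        exact ⟨hκ, Submodule.smul_mem _ _ (hsT 0).1.2⟩
      exact congr_fun (hsi (fun _ => κ) h1) 0
    · obtain ⟨c, hc⟩ := hss _ (hq i)
      exact ⟨c 0, hc⟩

end Existence

section ExistenceInduction

variable {k : Type} [Field k] {f : R4 k}

lemma exists_ne_zero_eval_eq_zero [IsAlgClosed k] (hf : f.IsHomogeneous 3) :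
    ∃ v : Fin 4 → k, v ≠ 0 ∧ eval v f = 0 := by
  set u : Fin 4 → k := Pi.single 0 1
  set w : Fin 4 → k := Pi.single 1 1
  by_cases hd : (lineRestrict w u f).degree = 0
  · have hconst : ∀ s : k, eval (w + s • u) f = eval w f := fun s => by
      rw [← eval_lineRestrict, Polynomial.eq_C_of_degree_eq_zero hd, Polynomial.eval_C]
      have := eval_lineRestrict w u f 0
      rw [zero_smul, add_zero, Polynomial.eq_C_of_degree_eq_zero hd, Polynomial.eval_C] at this
      exact this
    refine ⟨u, by simp [u], ?_⟩
    have := eval_add_smul_eq_zero (p := f - C (eval w f) * X 1 ^ 3) (u := u) (w := w) (T := {0}ᶜ)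
      (Set.finite_singleton 0).infinite_compl (fun c hc => ?_) 0
    · simpa [u] using this
    · have h1 : u + c • w = c • (w + c⁻¹ • u) := by
        rw [smul_add, smul_smul, mul_inv_cancel₀ hc, one_smul, add_comm]
      have h2 : eval (u + c • w) f = c ^ 3 * eval w f := by
        rw [h1, eval_smul_of_isHomogeneous hf, hconst]
      rw [map_sub, h2]
      simp [u, w]
      ring
  · obtain ⟨s, hs⟩ := IsAlgClosed.exists_root _ hd
    refine ⟨w + s • u, fun h => ?_, (eval_lineRestrict w u f s).symm.trans hs⟩
    have := congr_fun h 1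
    simp [w, u] at this

lemma good_zero {v : Fin 4 → k} (hv : v ≠ 0) (hvf : eval v f = 0) :
    Good f 0 (fun _ : Unit => v) := by
  refine ⟨fun _ => hv, fun _ => hvf, fun c hc => ?_, fun q hq _ i => ?_⟩
  · have := hc 1 (isHomogeneous_one _ _)
    funext i
    simpa using this
  · obtain ⟨h1, h2⟩ := hq i
    have h3 := h2 ()
    rw [totalDegree_eq_zero_iff_eq_C.mp (Nat.le_zero.mp h1.totalDegree_le)] at h3 ⊢
    rw [eval_C] at h3
    rw [h3, map_zero]
    exact dvd_zero f

lemma exists_good [IsAlgClosed k] (hf : f.IsHomogeneous 3) (hi : Irreducible f)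
    (hs : ∀ v : Fin 4 → k, v ≠ 0 → eval v f = 0 → ∃ i, eval v (pderiv i f) ≠ 0) (a : ℕ) :
    ∃ (ι : Type) (_ : Fintype ι) (z : ι → Fin 4 → k),
      2 * Fintype.card ι = 3 * a * a + a + 2 ∧ Good f a z := by
  induction a with
  | zero =>
    obtain ⟨v, hv, hvf⟩ := exists_ne_zero_eval_eq_zero hf
    exact ⟨Unit, inferInstance, _, by simp, good_zero hv hvf⟩
  | succ a ih =>
    obtain ⟨ι, _, z, hcard, h⟩ := ih
    have : Nonempty ι := Fintype.card_pos_iff.mp (by omega)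
    obtain ⟨η, e, he, hz, hirr⟩ := exists_irreducible_plane_section hf hi hs h.ne_zero
    obtain ⟨w, hw⟩ := h.exists_succ hf hi.prime hcard he hz hirr
    refine ⟨_, inferInstance, _, ?_, hw⟩
    rw [Fintype.card_sum, Fintype.card_sum, Fintype.card_fin, Fintype.card_fin, mul_add, hcard]
    ring

lemma Good.comp_equiv {a : ℕ} {ι κ : Type} [Fintype ι] [Fintype κ] {z : ι → Fin 4 → k}
    (h : Good f a z) (σ : κ ≃ ι) : Good f a (z ∘ σ) := by
  refine ⟨fun i => h.ne_zero _, fun i => h.vanish _, fun c hc => ?_, fun q hq => h.lift q ?_⟩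
  · have := h.indep (c ∘ σ.symm) fun q hq => by
      rw [← hc q hq, ← σ.sum_comp]
      simp
    funext i
    simpa using congr_fun this (σ i)
  · refine fun i => ⟨(hq i).1, fun l => ?_⟩
    simpa using (hq i).2 (σ.symm l)

end ExistenceInduction

section Openness

variable {k : Type} [Field k]

/-- Injectivity of a linear map depending polynomially on parameters is an open condition. -/
lemma exists_open_injective {σ κ V Q : Type*} [Fintype κ] [AddCommGroup V] [Module k V]
    [FiniteDimensional k V] [AddCommGroup Q] [Module k Q]
    (P : V →ₗ[k] (κ → MvPolynomial σ k)) (ψ : V →ₗ[k] Q) {v₀ : σ → k}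
    (h : ∀ x, (∀ s, eval v₀ (P x s) = 0) → ψ x = 0 → x = 0) :
    ∃ g : MvPolynomial σ k, eval v₀ g ≠ 0 ∧
      ∀ v, eval v g ≠ 0 → ∀ x, (∀ s, eval v (P x s) = 0) → ψ x = 0 → x = 0 := by
  classical
  let Φ : (σ → k) → V →ₗ[k] (κ → k) × Q := fun v =>
    (LinearMap.pi fun s => (aeval v).toLinearMap ∘ₗ LinearMap.proj s ∘ₗ P).prod ψ
  have hΦ : ∀ v x, Φ v x = (fun s => eval v (P x s), ψ x) := fun v x => by
    simp [Φ, funext_iff, aeval_eq_eval]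
  obtain ⟨r, hr⟩ := (Φ v₀).exists_leftInverse_of_injective (by
    refine LinearMap.ker_eq_bot'.mpr fun x hx => ?_
    rw [hΦ, Prod.mk_eq_zero] at hx
    exact h x (fun s => congr_fun hx.1 s) hx.2)
  let b := Module.finBasis k V
  let M : Matrix _ _ (MvPolynomial σ k) := Matrix.of fun i j =>
    ∑ s, C (b.repr (r (Pi.single s 1, 0)) i) * P (b j) s + C (b.repr (r (0, ψ (b j))) i)
  have hM : ∀ v, eval v M.det = LinearMap.det (r ∘ₗ Φ v) := fun v => by
    rw [← LinearMap.det_toMatrix b, RingHom.map_det]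
    congr 1
    ext i j
    have h1 : Φ v (b j) = ∑ s, eval v (P (b j) s) • ((Pi.single s 1, 0) : (κ → k) × Q)
        + (0, ψ (b j)) := by
      rw [hΦ]
      ext s
      · simp [Prod.fst_sum, Pi.single_apply]
      · simp [Prod.snd_sum]
    rw [LinearMap.toMatrix_apply, LinearMap.comp_apply, h1, map_add, map_sum]
    simp_rw [map_smul]
    simp [M, mul_comm]
  refine ⟨M.det, ?_, fun v hv x hx hψ => ?_⟩
  · rw [hM, hr, LinearMap.det_id]
    exact one_ne_zero
  · rw [hM] at hv
    have h1 : (r ∘ₗ Φ v) x = 0 := by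
      rw [LinearMap.comp_apply, hΦ, hψ, funext hx]
      exact map_zero r
    exact (LinearMap.equivOfDetNeZero _ hv).injective (h1.trans (map_zero _).symm)

variable {f : R4 k} {a t : ℕ}

lemma eval_rename_prodMk (v : Fin t → Fin 4 → k) (i : Fin t) (p : R4 k) :
    eval (fun q : Fin t × Fin 4 => v q.1 q.2) (rename (fun j => (i, j)) p) = eval (v i) p :=
  eval_rename _ _ _

lemma exists_open_indep {z : Fin t → Fin 4 → k} (h : Sep z a) :
    ∃ g : MvPolynomial (Fin t × Fin 4) k, eval (fun q => z q.1 q.2) g ≠ 0 ∧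
      ∀ v : Fin t → Fin 4 → k, eval (fun q => v q.1 q.2) g ≠ 0 →
        ∀ c : Fin t → k, (∀ q : R4 k, q.IsHomogeneous a → ∑ i, c i * eval (v i) q = 0) → c = 0 := by
  choose q hq hqz using fun j => h (Pi.single j 1)
  let M : Matrix (Fin t) (Fin t) (MvPolynomial (Fin t × Fin 4) k) :=
    Matrix.of fun i j => rename (fun l => (i, l)) (q j)
  have hM : ∀ v : Fin t → Fin 4 → k, eval (fun q => v q.1 q.2) M.det =
      (Matrix.of fun i j => eval (v i) (q j)).det := fun v => by
    rw [RingHom.map_det]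
    congr 1
    ext i j
    exact eval_rename_prodMk v i (q j)
  refine ⟨M.det, ?_, fun v hv c hc => ?_⟩
  · have h1 : (Matrix.of fun i j => eval (z i) (q j)) = 1 := by
      ext i j
      rw [Matrix.of_apply, hqz, Matrix.one_apply, Pi.single_apply]
    rw [hM, h1, Matrix.det_one]
    exact one_ne_zero
  · rw [hM] at hv
    refine Matrix.eq_zero_of_vecMul_eq_zero hv (funext fun j => ?_)
    exact hc (q j) (hq j)

lemma exists_open_lift {z : Fin t → Fin 4 → k}
    (h : ∀ q : Fin 4 → R4 k, (∀ i, q i ∈ Iz z a) → f ∣ ∑ i, X i * q i → ∀ i, f ∣ q i) :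
    ∃ g : MvPolynomial (Fin t × Fin 4) k, eval (fun q => z q.1 q.2) g ≠ 0 ∧
      ∀ v : Fin t → Fin 4 → k, (∀ i, eval (v i) f = 0) → eval (fun q => v q.1 q.2) g ≠ 0 →
        ∀ q : Fin 4 → R4 k, (∀ i, q i ∈ Iz v a) → f ∣ ∑ i, X i * q i → ∀ i, f ∣ q i := by
  have hle : Fd f a ≤ homogeneousSubmodule (Fin 4) k a := inf_le_left
  obtain ⟨n, hn⟩ := Nat.exists_eq_add_of_le (Submodule.finrank_mono hle)
  obtain ⟨b, hb, hbi, hbs⟩ := exists_basis_mod hle hn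
  let G : (Fin n → k) →ₗ[k] R4 k := Fintype.linearCombination k b
  have hG : ∀ c, (G c).IsHomogeneous a := fun c =>
    Submodule.sum_mem (homogeneousSubmodule (Fin 4) k a) fun j _ => Submodule.smul_mem _ _ (hb j)
  have hGf : ∀ c, f ∣ G c → c = 0 := fun c hc => hbi c (mem_fd.mpr ⟨hG c, hc⟩)
  let K : Submodule k (R4 k) := (Ideal.span {f}).restrictScalars k
  let P : (Fin 4 → Fin n → k) →ₗ[k] (Fin 4 × Fin t → MvPolynomial (Fin t × Fin 4) k) :=
    LinearMap.pi fun s => (rename fun j => (s.2, j)).toLinearMap ∘ₗ G ∘ₗ LinearMap.proj s.1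
  let ψ : (Fin 4 → Fin n → k) →ₗ[k] R4 k ⧸ K :=
    K.mkQ ∘ₗ ∑ i, LinearMap.mulLeft k (X i) ∘ₗ G ∘ₗ LinearMap.proj i
  have hP : ∀ (v : Fin t → Fin 4 → k) (x : Fin 4 → Fin n → k),
      (∀ s, eval (fun q => v q.1 q.2) (P x s) = 0) ↔ ∀ i l, eval (v l) (G (x i)) = 0 :=
    fun v x => by
      rw [Prod.forall]
      exact forall₂_congr fun i l => by rw [← eval_rename_prodMk v]; rfl
  have hψ : ∀ x : Fin 4 → Fin n → k, ψ x = 0 ↔ f ∣ ∑ i, X i * G (x i) := fun x => by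
    have h1 : ψ x = K.mkQ (∑ i, X i * G (x i)) := by
      simp only [ψ, LinearMap.comp_apply, LinearMap.sum_apply]
      rfl
    rw [h1, Submodule.mkQ_apply, Submodule.Quotient.mk_eq_zero]
    exact Ideal.mem_span_singleton
  obtain ⟨g, hg, hgv⟩ := exists_open_injective P ψ (v₀ := fun q : Fin t × Fin 4 => z q.1 q.2)
    fun x h1 h2 => by
      rw [hP] at h1
      rw [hψ] at h2
      exact funext fun i => hGf _ (h (fun i => G (x i)) (fun i => ⟨hG _, h1 i⟩) h2 i)
  refine ⟨g, hg, fun v hvf hv q hq hdvd => ?_⟩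
  choose x hx using fun i => hbs (q i) (hq i).1
  have hqG : ∀ i, f ∣ q i - G (x i) := fun i => (mem_fd.mp (hx i)).2
  have hx0 : x = 0 := by
    refine hgv _ hv _ ((hP v _).mpr fun i l => ?_) ((hψ _).mpr ?_)
    · have h1 := (hq i).2 l
      obtain ⟨w, hw⟩ := hqG i
      rwa [sub_eq_iff_eq_add.mp hw, map_add, map_mul, hvf, zero_mul, zero_add] at h1
    · have h1 : ∑ i, X i * G (x i) = ∑ i, X i * q i - ∑ i, X i * (q i - G (x i)) := by
        rw [← Finset.sum_sub_distrib]
        exact Finset.sum_congr rfl fun i _ => by ring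
      rw [h1]
      exact dvd_sub hdvd (Finset.dvd_sum fun i _ => (hqG i).mul_left _)
  intro i
  simpa [hx0] using hqG i

lemma Good.exists_open {z : Fin t → Fin 4 → k} (h : Good f a z) :
    ∃ g : MvPolynomial (Fin t × Fin 4) k, eval (fun q => z q.1 q.2) g ≠ 0 ∧
      ∀ v : Fin t → Fin 4 → k, (∀ i, v i ≠ 0) → (∀ i, eval (v i) f = 0) →
        eval (fun q => v q.1 q.2) g ≠ 0 → Good f a v := by
  obtain ⟨g₁, hg₁, h₁⟩ := exists_open_indep (h.sep le_rfl)
  obtain ⟨g₂, hg₂, h₂⟩ := exists_open_lift h.lift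
  refine ⟨g₁ * g₂, ?_, fun v hv hvf hvg => ?_⟩
  · rw [map_mul]
    exact mul_ne_zero hg₁ hg₂
  · rw [map_mul] at hvg
    exact ⟨hv, hvf, h₁ v (left_ne_zero_of_mul hvg), h₂ v hvf (right_ne_zero_of_mul hvg)⟩

end Openness

section Configurations

variable {k : Type} [Field k] {a t : ℕ}

lemma Good.configOn {S : SmoothCubicSurface k} {z : Fin t → Fin 4 → k} (h : Good S.f a z) :
    ConfigOn k S fun i => Projectivization.mk k (z i) (h.ne_zero i) := by
  refine ⟨fun i j hij => ?_, fun i v hv hvi => ?_⟩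
  · by_contra hne
    obtain ⟨c, hc⟩ := (Projectivization.mk_eq_mk_iff' k _ _ _ _).mp hij
    obtain ⟨q, hq, hqz⟩ := h.sep le_rfl (Pi.single i 1)
    have h1 := hqz i
    rw [← hc, eval_smul_of_isHomogeneous hq, hqz j, Pi.single_eq_of_ne (Ne.symm hne),
      mul_zero, Pi.single_eq_same] at h1
    exact zero_ne_one h1
  · obtain ⟨c, rfl⟩ := (Projectivization.mk_eq_mk_iff' k _ _ _ _).mp hvi
    rw [eval_smul_of_isHomogeneous S.homog, h.vanish, mul_zero]

end Configurations

end MRC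

/-- For `a ≥ 3`, a general set `Z` of `p(a) = (3/2)a(a-1) + 2a + 1` points on a
smooth cubic surface `X ⊂ ℙ³` has graded minimal free resolution
`0 → R(-a-3)^(2a) → R(-a-2)^(3a+3) → R(-a)^a ⊕ R(-a-1)^3 ⊕ R(-3) → I_Z → 0`. -/
theorem mrc_cubic_resolution_p (k : Type) [Field k] [IsAlgClosed k]
    (S : SmoothCubicSurface k) (a : ℕ) (ha : 3 ≤ a) :
    GeneralPointsSatisfy k S (3 * (a * (a - 1) / 2) + 2 * a + 1) (fun Z =>
      HasMinFreeRes3 k ⊥ (pointsIdeal k (Set.range Z))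
        (Fin.append (Fin.append (fun _ : Fin (a) => a) (fun _ : Fin (3) => a + 1)) (fun _ : Fin (1) => 3))
        (fun _ : Fin (3 * a + 3) => a + 2)
        (fun _ : Fin (2 * a) => a + 3)) := by
  have ht : 2 * (3 * (a * (a - 1) / 2) + 2 * a + 1) = 3 * a * a + a + 2 := by
    have h1 := Nat.div_mul_cancel (Nat.even_mul_pred_self a).two_dvd
    obtain ⟨b, rfl⟩ := Nat.exists_eq_add_of_le' ha
    rw [show b + 3 - 1 = b + 2 from rfl] at h1 ⊢
    nlinarith
  obtain ⟨ι, _, z, hcard, hz⟩ := MRC.exists_good S.homog S.irred S.smooth a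
  have σ : Fin (3 * (a * (a - 1) / 2) + 2 * a + 1) ≃ ι :=
    Fintype.equivOfCardEq (by rw [Fintype.card_fin]; omega)
  have hσ := hz.comp_equiv σ
  obtain ⟨g, hg, hgood⟩ := hσ.exists_open
  refine ⟨g, ⟨_, hσ.configOn, _, fun i => ⟨hσ.ne_zero i, rfl⟩, hg⟩, ?_⟩
  rintro Z ⟨-, hZ⟩ ⟨v, hv, hvg⟩
  have hgv := hgood v (fun i => (hv i).1) (fun i => hZ i _ (hv i).1 (hv i).2) hvg
  exact hgv.hasMinFreeRes3 hv S.homog S.irred.prime ht ha
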